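/- arXiv:2505.13939 — 4 statements merged into one kernel-verified Lean document; each statement's English description precedes it below -/
import Mathlib

section
/- Let φ be a function of class C⁸ on a neighborhood U of the origin in ℝ² with φ(0) = 0 and all partial derivatives of order ≤ 2 of φ vanishing at the origin, and let p₃, p₄ and p₅ be the third, fourth and fifth Taylor homogeneous parts of φ at the origin. Then the following are equivalent: (i) φ has a singularity of type E₈ at the origin; (ii) there exist a nonzero real constant c and a nonzero linear form ℓ on ℝ² with p₃ = c·ℓ³, the square ℓ² divides p₄, and the polynomials p₃ and p₅ have no common zero in ℝ² ∖ {0}. -/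
open Set MvPolynomial

/-- The mixed partial derivative `∂₁^i ∂₂^j φ (0,0)`. -/
noncomputable def mixedPartial (φ : ℝ × ℝ → ℝ) (i j : ℕ) : ℝ :=
  iteratedDeriv i (fun s => iteratedDeriv j (fun t => φ (s, t)) 0) 0

/-- `φ` (with domain `U`, a neighborhood of the origin) has a singularity of type `E₈`
at the origin: there are a neighborhood `V` of `0` and a `C¹` map `ϕ` with `ϕ 0 = 0`,
`ϕ '' V ⊆ U` and nonzero Jacobian determinant at `0`, with
`φ (ϕ y) = y₁⁵ + y₂³` on `V`. -/
def HasE8 (φ : ℝ × ℝ → ℝ) (U : Set (ℝ × ℝ)) : Prop :=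
  ∃ V ∈ nhds (0 : ℝ × ℝ), ∃ ϕ : ℝ × ℝ → ℝ × ℝ,
    ContDiffOn ℝ 1 ϕ V ∧ ϕ 0 = 0 ∧ ϕ '' V ⊆ U ∧
    LinearMap.det ((fderiv ℝ ϕ 0) : (ℝ × ℝ) →ₗ[ℝ] ℝ × ℝ) ≠ 0 ∧
    ∀ y ∈ V, φ (ϕ y) = y.1 ^ 5 + y.2 ^ 3

open scoped Topology

/-- An integral over `[0, 1]` of a `C^n` function depending on parameters is `C^n`. -/
lemma contDiff_integral_zero_one {P : Type*} [NormedAddCommGroup P] [NormedSpace ℝ P] {n : ℕ}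
    {k : P → ℝ → ℝ} (hk : ContDiff ℝ n (fun q : P × ℝ => k q.1 q.2)) :
    ContDiff ℝ n (fun p => ∫ τ in (0 : ℝ)..1, k p τ) := by
  let χ : ContDiffBump (0 : ℝ) := ⟨1, 2, by norm_num, by norm_num⟩
  have hχ : ContDiff ℝ n (χ : ℝ → ℝ) := χ.contDiff
  have key := MeasureTheory.contDiffOn_convolution_right_with_param_comp (𝕜 := ℝ) (n := (n : ℕ∞))
    (μ := MeasureTheory.volume) (G := ℝ)
    (ContinuousLinearMap.mul ℝ ℝ) (s := (univ : Set P)) (v := fun _ => (1 : ℝ))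
    contDiffOn_const (f := (Ioc (0 : ℝ) 1).indicator (fun _ => (1 : ℝ)))
    (g := fun p τ => χ τ * k p τ) (k := Metric.closedBall 0 2) isOpen_univ
    (isCompact_closedBall _ _) ?_ ?_ ?_
  · rw [contDiffOn_univ] at key
    convert! key using 2 with p
    simp only [MeasureTheory.convolution, ContinuousLinearMap.mul_apply']
    have h1 : ∀ t : ℝ, (Ioc (0 : ℝ) 1).indicator (fun _ => (1 : ℝ)) t * (χ (1 - t) * k p (1 - t))
        = (Ioc (0 : ℝ) 1).indicator (fun t => k p (1 - t)) t := by
      intro t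
      by_cases ht : t ∈ Ioc (0 : ℝ) 1
      · have : χ (1 - t) = 1 := χ.one_of_mem_closedBall (by
          rw [Metric.mem_closedBall, dist_zero_right, Real.norm_eq_abs, abs_le]
          exact ⟨by linarith [ht.2], by show 1 - t ≤ 1; linarith [ht.1]⟩)
        simp [ht, this]
      · simp [ht]
    simp_rw [h1]
    rw [MeasureTheory.integral_indicator measurableSet_Ioc,
      ← intervalIntegral.integral_of_le zero_le_one,
      intervalIntegral.integral_comp_sub_left (fun t => k p t) 1]
    simp
  · intro p x _ hx
    have : χ x = 0 := χ.zero_of_le_dist (by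
      rw [Metric.mem_closedBall, not_le] at hx; exact hx.le)
    simp [this]
  · refine (MeasureTheory.IntegrableOn.integrable_indicator ?_ measurableSet_Ioc).locallyIntegrable
    simp
  · exact ((hχ.comp contDiff_snd).mul hk).contDiffOn

/-- Hadamard's lemma in the second variable. -/
lemma exists_eq_add_snd_mul {n : ℕ} {f : ℝ × ℝ → ℝ} (hf : ContDiff ℝ (n + 1 : ℕ) f) :
    ∃ g : ℝ × ℝ → ℝ, ContDiff ℝ n g ∧ ∀ x y, f (x, y) = f (x, 0) + y * g (x, y) := by
  have hf' : ContDiff ℝ n (fderiv ℝ f) := hf.fderiv_right (by norm_cast)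
  refine ⟨fun p => ∫ τ in (0 : ℝ)..1, fderiv ℝ f (p.1, τ * p.2) (0, 1), ?_, ?_⟩
  · apply contDiff_integral_zero_one (P := ℝ × ℝ) (k := fun p τ => fderiv ℝ f (p.1, τ * p.2) (0, 1))
    exact (hf'.comp (by fun_prop)).clm_apply contDiff_const
  · intro x y
    have hd : ∀ τ : ℝ, HasDerivAt (fun τ : ℝ => f (x, τ * y))
        (y * fderiv ℝ f (x, τ * y) (0, 1)) τ := by
      intro τ
      have h1 : HasFDerivAt f (fderiv ℝ f (x, τ * y)) (x, τ * y) :=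
        (hf.differentiable (by norm_cast)).differentiableAt.hasFDerivAt
      have h2 : HasDerivAt (fun τ : ℝ => (x, τ * y)) ((0 : ℝ), y) τ := by
        simpa using (hasDerivAt_const τ x).prodMk ((hasDerivAt_id τ).mul_const y)
      have h3 := h1.comp_hasDerivAt τ h2
      have h4 : ((0 : ℝ), y) = y • ((0 : ℝ), (1 : ℝ)) := by simp
      rw [h4, map_smul, smul_eq_mul] at h3
      exact h3
    have hc : Continuous fun τ : ℝ => y * fderiv ℝ f (x, τ * y) (0, 1) := by
      have := hf'.continuous
      fun_prop
    have := intervalIntegral.integral_eq_sub_of_hasDerivAt (a := 0) (b := 1) (fun τ _ => hd τ)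
      (hc.intervalIntegrable _ _)
    simp only [intervalIntegral.integral_const_mul, one_mul, zero_mul] at this
    simp only [this]; ring

lemma iteratedDeriv_succ_const_add_id_mul {n j : ℕ} {g : ℝ → ℝ} (hg : ContDiff ℝ n g)
    (hj : j + 1 ≤ n) (c : ℝ) :
    iteratedDeriv (j + 1) (fun t => c + t * g t) 0 = (j + 1) * iteratedDeriv j g 0 := by
  rw [iteratedDeriv_const_add (Nat.succ_pos j)]
  have h := iteratedDeriv_mul (n := j + 1) (x := (0 : ℝ)) (f := fun t : ℝ => t) (g := g)
    contDiffAt_id (hg.contDiffAt.of_le (by exact_mod_cast hj))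
  have h' : (fun t : ℝ => t * g t) = (fun t : ℝ => t) * g := rfl
  rw [h', h, Finset.sum_eq_single 1]
  · simp [iteratedDeriv_fun_id_zero]
  · intro b _ hb
    simp [iteratedDeriv_fun_id_zero, hb]
  · simp

/-- Taylor expansion in the second variable at `0`, with a remainder of controlled regularity. -/
lemma exists_taylor_snd (m k : ℕ) {f : ℝ × ℝ → ℝ} (hf : ContDiff ℝ (m + k : ℕ) f) :
    (∀ j < k, ContDiff ℝ (m + k - j : ℕ) fun x => iteratedDeriv j (fun t => f (x, t)) 0) ∧
    ∃ g : ℝ × ℝ → ℝ, ContDiff ℝ m g ∧ ∀ x y, f (x, y) =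
      ∑ j ∈ Finset.range k, iteratedDeriv j (fun t => f (x, t)) 0 / j.factorial * y ^ j
        + y ^ k * g (x, y) := by
  induction k generalizing f with
  | zero => exact ⟨by simp, f, hf, by simp⟩
  | succ k ih =>
    obtain ⟨g₁, hg₁, hfg⟩ := exists_eq_add_snd_mul hf
    obtain ⟨hreg, g, hg, hexp⟩ := ih hg₁
    have hsucc : ∀ j < k, ∀ x, iteratedDeriv (j + 1) (fun t => f (x, t)) 0 =
        (j + 1) * iteratedDeriv j (fun t => g₁ (x, t)) 0 := by
      intro j hj x
      rw [show (fun t => f (x, t)) = fun t => f (x, 0) + t * g₁ (x, t) from funext (hfg x)]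
      exact iteratedDeriv_succ_const_add_id_mul (n := m + k) (hg₁.comp (by fun_prop)) (by omega) _
    refine ⟨?_, g, hg, ?_⟩
    · rintro (_ | j) hj
      · simp only [iteratedDeriv_zero]
        exact hf.comp (by fun_prop)
      · simp_rw [hsucc j (by omega)]
        have := hreg j (by omega)
        rw [show m + (k + 1) - (j + 1) = m + k - j by omega]
        fun_prop
    · intro x y
      rw [hfg, hexp, Finset.sum_range_succ', iteratedDeriv_zero, mul_add, Finset.mul_sum]
      have : ∀ j ∈ Finset.range k, y * (iteratedDeriv j (fun t => g₁ (x, t)) 0 / j.factorial * y ^ j)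
          = iteratedDeriv (j + 1) (fun t => f (x, t)) 0 / (j + 1).factorial * y ^ (j + 1) := by
        intro j hj
        rw [hsucc j (Finset.mem_range.1 hj), Nat.factorial_succ]
        have : (j.factorial : ℝ) ≠ 0 := by positivity
        have : (j : ℝ) + 1 ≠ 0 := by positivity
        push_cast
        field_simp
        ring
      rw [Finset.sum_congr rfl this]
      simp
      ring

/-- The Taylor coefficient of `x ^ i * y ^ j` at the origin. -/
noncomputable def taylorCoeff (φ : ℝ × ℝ → ℝ) (i j : ℕ) : ℝ :=
  mixedPartial φ i j / (i.factorial * j.factorial)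

/-- Taylor expansion of order six at the origin of a `C^8` function of two variables. -/
lemma exists_taylor_six {φ : ℝ × ℝ → ℝ} (hφ : ContDiff ℝ 8 φ) :
    ∃ h : ℕ → ℝ × ℝ → ℝ, (∀ j, ContDiff ℝ 2 (h j)) ∧ ∀ x y, φ (x, y) =
      ∑ j ∈ Finset.range 6, ∑ i ∈ Finset.range (6 - j), taylorCoeff φ i j * x ^ i * y ^ j
        + ∑ j ∈ Finset.range 7, x ^ (6 - j) * y ^ j * h j (x, y) := by
  obtain ⟨hreg, g, hg, hexp⟩ := exists_taylor_snd 2 6 (f := φ) (by exact_mod_cast hφ)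
  have hb : ∀ j : ℕ, ∃ b : ℝ × ℝ → ℝ, ContDiff ℝ 2 b ∧ (j < 6 → ∀ x y : ℝ,
      iteratedDeriv j (fun t => φ (x, t)) 0 = ∑ i ∈ Finset.range (6 - j),
        mixedPartial φ i j / i.factorial * x ^ i + x ^ (6 - j) * b (x, y)) := by
    intro j
    by_cases hj : j < 6
    · have h1 := hreg j hj
      rw [show 2 + 6 - j = 2 + (6 - j) by omega] at h1
      obtain ⟨-, b, hb, hb'⟩ := exists_taylor_snd 2 (6 - j)
        (f := fun p => iteratedDeriv j (fun t => φ (p.2, t)) 0) (h1.comp contDiff_snd)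
      exact ⟨fun p => b (0, p.1), ContDiff.comp (g := b) (by exact_mod_cast hb) (by fun_prop),
        fun _ x y => hb' 0 x⟩
    · exact ⟨0, contDiff_const, fun h => absurd h hj⟩
  choose b hb hb' using hb
  refine ⟨fun j => if j < 6 then fun p => b j p / j.factorial else g, ?_, ?_⟩
  · intro j
    by_cases hj : j < 6
    · simp only [hj, if_true]
      exact (hb j).div_const _
    · simp only [hj, if_false]
      exact_mod_cast hg
  · intro x y
    rw [hexp, Finset.sum_range_succ _ 6, ← add_assoc, ← Finset.sum_add_distrib]
    simp only [lt_irrefl, if_false, Nat.sub_self, pow_zero, one_mul]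
    congr 1
    refine Finset.sum_congr rfl fun j hj => ?_
    have hj := Finset.mem_range.1 hj
    rw [hb' j hj x y, if_pos hj, add_div, add_mul, Finset.sum_div, Finset.sum_mul]
    congr 1
    · refine Finset.sum_congr rfl fun i _ => ?_
      rw [taylorCoeff]
      field_simp
    · ring

lemma eq_zero_of_sum_add_pow_mul_eq_zero {n : ℕ} {a : ℕ → ℝ} {H : ℝ → ℝ} (hH : Continuous H)
    (h : ∀ t, ∑ k ∈ Finset.range n, a k * t ^ k + t ^ n * H t = 0) : ∀ k < n, a k = 0 := by
  induction n generalizing a with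
  | zero => simp
  | succ n ih =>
    have h0 : a 0 = 0 := by simpa [Finset.sum_range_succ'] using h 0
    have h1 : ∀ t, ∑ k ∈ Finset.range n, a (k + 1) * t ^ k + t ^ n * H t = 0 := by
      refine fun t => congrFun (Continuous.ext_on (dense_compl_singleton (0 : ℝ))
        (f := fun t => ∑ k ∈ Finset.range n, a (k + 1) * t ^ k + t ^ n * H t) (g := fun _ => 0)
        (by fun_prop) (by fun_prop) fun t ht => ?_) t
      have := h t
      rw [Finset.sum_range_succ', h0, zero_mul, add_zero] at this
      refine (mul_eq_zero.1 ?_).resolve_left (show t ≠ 0 from ht)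
      rw [← this, mul_add, Finset.mul_sum]
      congr 1
      · exact Finset.sum_congr rfl fun _ _ => by ring
      · ring
    rintro (_ | k) hk
    · exact h0
    · exact ih h1 k (by omega)

/-- The homogeneous part of degree `k` of the Taylor expansion at the origin. -/
noncomputable def homPart (φ : ℝ × ℝ → ℝ) (k : ℕ) (z : ℝ × ℝ) : ℝ :=
  ∑ i ∈ Finset.range (k + 1), taylorCoeff φ i (k - i) * z.1 ^ i * z.2 ^ (k - i)

lemma exists_homPart_expansion {φ : ℝ × ℝ → ℝ} (hφ : ContDiff ℝ 8 φ) (z : ℝ × ℝ) :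
    ∃ H : ℝ → ℝ, Continuous H ∧ ∀ t : ℝ, φ (t • z) =
      ∑ k ∈ Finset.range 6, homPart φ k z * t ^ k + t ^ 6 * H t := by
  obtain ⟨h, hh, hexp⟩ := exists_taylor_six hφ
  refine ⟨fun t => ∑ j ∈ Finset.range 7, z.1 ^ (6 - j) * z.2 ^ j * h j (t * z.1, t * z.2), ?_, fun t => ?_⟩
  · have := fun j => (hh j).continuous
    fun_prop
  · rw [show t • z = (t * z.1, t * z.2) from rfl, hexp]
    simp only [Finset.sum_range_succ, Finset.sum_range_zero, homPart]
    norm_num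
    ring

lemma homPart_comp {φ : ℝ × ℝ → ℝ} (hφ : ContDiff ℝ 8 φ) (L : ℝ × ℝ →L[ℝ] ℝ × ℝ) {k : ℕ}
    (hk : k < 6) (z : ℝ × ℝ) : homPart (φ ∘ L) k z = homPart φ k (L z) := by
  obtain ⟨H, hH, h⟩ := exists_homPart_expansion hφ (L z)
  obtain ⟨H', hH', h'⟩ := exists_homPart_expansion (hφ.comp L.contDiff) z
  refine sub_eq_zero.1 (eq_zero_of_sum_add_pow_mul_eq_zero (n := 6)
    (a := fun k => homPart (φ ∘ L) k z - homPart φ k (L z)) (H := fun t => H' t - H t)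
    (by fun_prop) (fun t => ?_) k hk)
  have h1 := h t
  have h2 := h' t
  rw [Function.comp_apply, map_smul, h1] at h2
  simp only [sub_mul, Finset.sum_sub_distrib, mul_sub]
  linarith

/-- The equation of an `E₈` singularity, in terms of germs. -/
def HasE8Germ (φ : ℝ × ℝ → ℝ) : Prop :=
  ∃ ψ : ℝ × ℝ → ℝ × ℝ, ContDiffAt ℝ 1 ψ 0 ∧ ψ 0 = 0 ∧
    LinearMap.det ((fderiv ℝ ψ 0) : (ℝ × ℝ) →ₗ[ℝ] ℝ × ℝ) ≠ 0 ∧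
    ∀ᶠ y in 𝓝 (0 : ℝ × ℝ), φ (ψ y) = y.1 ^ 5 + y.2 ^ 3

lemma hasE8_iff_hasE8Germ {φ Φ : ℝ × ℝ → ℝ} {U : Set (ℝ × ℝ)} (hU : U ∈ 𝓝 (0 : ℝ × ℝ))
    (hΦ : Φ =ᶠ[𝓝 0] φ) : HasE8 φ U ↔ HasE8Germ Φ := by
  constructor
  · rintro ⟨V, hV, ψ, hψ, h0, -, hdet, heq⟩
    have hψ' := hψ.contDiffAt hV
    refine ⟨ψ, hψ', h0, hdet, ?_⟩
    have hc : Filter.Tendsto ψ (𝓝 0) (𝓝 0) := by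
      simpa [ContinuousAt, h0] using hψ'.continuousAt
    filter_upwards [hV, hc.eventually hΦ] with y hy hy'
    rw [hy', heq y hy]
  · rintro ⟨ψ, hψ, h0, hdet, heq⟩
    have hc : Filter.Tendsto ψ (𝓝 0) (𝓝 0) := by
      simpa [ContinuousAt, h0] using hψ.continuousAt
    obtain ⟨W, hW, hψW⟩ := hψ.contDiffOn le_rfl (by simp)
    refine ⟨W ∩ (ψ ⁻¹' U ∩ {y | Φ (ψ y) = y.1 ^ 5 + y.2 ^ 3 ∧ Φ (ψ y) = φ (ψ y)}),
      Filter.inter_mem hW (Filter.inter_mem (hc hU) (heq.and (hc.eventually hΦ))),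
      ψ, hψW.mono inter_subset_left, h0, ?_, hdet, ?_⟩
    · rintro _ ⟨y, hy, rfl⟩
      exact hy.2.1
    · intro y hy
      rw [← hy.2.2.2, hy.2.2.1]

lemma hasE8Germ_comp_iff {φ : ℝ × ℝ → ℝ} (L : (ℝ × ℝ) ≃L[ℝ] ℝ × ℝ) :
    HasE8Germ (φ ∘ L) ↔ HasE8Germ φ := by
  have key : ∀ (φ : ℝ × ℝ → ℝ) (L : (ℝ × ℝ) ≃L[ℝ] ℝ × ℝ), HasE8Germ (φ ∘ L) → HasE8Germ φ := by
    rintro φ L ⟨ψ, hψ, h0, hdet, heq⟩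
    refine ⟨L ∘ ψ, L.contDiff.contDiffAt.comp _ hψ, by simp [h0], ?_, heq⟩
    rw [L.comp_fderiv, ContinuousLinearMap.toLinearMap_comp, LinearMap.det_comp]
    exact mul_ne_zero (LinearEquiv.isUnit_det' L.toLinearEquiv).ne_zero hdet
  refine ⟨key φ L, fun h => key (φ ∘ L) L.symm ?_⟩
  simpa [Function.comp_assoc] using h

/-- A function that is `C^n` near the origin agrees near the origin with a globally `C^n` one. -/
lemma exists_contDiff_eventuallyEq {n : ℕ} {φ : ℝ × ℝ → ℝ} {U : Set (ℝ × ℝ)}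
    (hU : U ∈ 𝓝 (0 : ℝ × ℝ)) (hφ : ContDiffOn ℝ n φ U) :
    ∃ Φ : ℝ × ℝ → ℝ, ContDiff ℝ n Φ ∧ Φ =ᶠ[𝓝 0] φ := by
  obtain ⟨R, hR, hRU⟩ := Metric.mem_nhds_iff.1 hU
  let χ : ContDiffBump (0 : ℝ × ℝ) := ⟨R / 4, R / 2, by linarith, by linarith⟩
  refine ⟨fun z => χ z * φ z, contDiff_iff_contDiffAt.2 fun z => ?_, ?_⟩
  · by_cases hz : z ∈ Metric.ball (0 : ℝ × ℝ) R
    · exact χ.contDiff.contDiffAt.mul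
        (hφ.contDiffAt (Filter.mem_of_superset (Metric.isOpen_ball.mem_nhds hz) hRU))
    · have hz' : z ∉ tsupport χ := by
        rw [χ.tsupport_eq]
        intro h
        have h1 : dist z 0 ≤ R / 2 := Metric.mem_closedBall.1 h
        exact hz (Metric.mem_ball.2 (by linarith))
      refine (contDiffAt_const (c := (0 : ℝ))).congr_of_eventuallyEq ?_
      filter_upwards [notMem_tsupport_iff_eventuallyEq.1 hz'] with y hy
      simp [hy]
  · filter_upwards [χ.eventuallyEq_one] with z hz
    simp [hz]

lemma mixedPartial_congr {φ Φ : ℝ × ℝ → ℝ} (h : Φ =ᶠ[𝓝 0] φ) (i j : ℕ) :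
    mixedPartial Φ i j = mixedPartial φ i j := by
  have h' : ∀ᶠ p in 𝓝 ((0 : ℝ), (0 : ℝ)), Φ p = φ p := h
  rw [nhds_prod_eq] at h'
  refine Filter.EventuallyEq.iteratedDeriv_eq i ?_
  filter_upwards [h'.curry] with s hs
  exact Filter.EventuallyEq.iteratedDeriv_eq j hs

lemma exists_pow_eq_of_odd {n : ℕ} (hn : Odd n) (a : ℝ) : ∃ b : ℝ, b ^ n = a := by
  have hn0 : n ≠ 0 := hn.pos.ne'
  rcases le_total 0 a with ha | ha
  · exact ⟨a ^ (n⁻¹ : ℝ), Real.rpow_inv_natCast_pow ha hn0⟩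
  · exact ⟨-(-a) ^ (n⁻¹ : ℝ), by
      rw [hn.neg_pow, Real.rpow_inv_natCast_pow (by linarith) hn0, neg_neg]⟩

/-- The equations which express that
`(x e + y a)⁵ + (y c + x² d)³ = x⁵ u + x⁴ y v + x² y² r + y³ w`. -/
lemma exists_solution_coefficients {u v r w : ℝ × ℝ → ℝ} (hu : ContDiffAt ℝ 1 u 0)
    (hv : ContDiffAt ℝ 1 v 0) (hr : ContDiffAt ℝ 1 r 0) (hw : ContDiffAt ℝ 1 w 0)
    (hu0 : u 0 ≠ 0) (hw0 : w 0 ≠ 0) :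
    ∃ e c d a : ℝ × ℝ → ℝ, ContDiffAt ℝ 1 e 0 ∧ ContDiffAt ℝ 1 c 0 ∧ ContDiffAt ℝ 1 d 0 ∧
      ContDiffAt ℝ 1 a 0 ∧ e 0 ≠ 0 ∧ c 0 ≠ 0 ∧ ∀ᶠ p in 𝓝 (0 : ℝ × ℝ),
        e p ^ 5 + p.1 * d p ^ 3 = u p ∧
        c p ^ 3 + 10 * p.1 ^ 2 * e p ^ 2 * a p ^ 3 + 5 * p.1 * p.2 * e p * a p ^ 4
          + p.2 ^ 2 * a p ^ 5 = w p ∧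
        10 * p.1 * e p ^ 3 * a p ^ 2 + 3 * c p ^ 2 * d p = r p ∧
        5 * e p ^ 4 * a p + 3 * c p * d p ^ 2 = v p := by
  obtain ⟨e₀, he₀⟩ := exists_pow_eq_of_odd (n := 5) (by decide) (u 0)
  obtain ⟨c₀, hc₀⟩ := exists_pow_eq_of_odd (n := 3) (by decide) (w 0)
  have he : e₀ ≠ 0 := by rintro rfl; simp at he₀; exact hu0 he₀.symm
  have hc : c₀ ≠ 0 := by rintro rfl; simp at hc₀; exact hw0 hc₀.symm
  obtain ⟨d₀, hd₀⟩ : ∃ d₀ : ℝ, 3 * c₀ ^ 2 * d₀ = r 0 := ⟨r 0 / (3 * c₀ ^ 2), by field_simp⟩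
  obtain ⟨a₀, ha₀⟩ : ∃ a₀ : ℝ, 5 * e₀ ^ 4 * a₀ + 3 * c₀ * d₀ ^ 2 = v 0 :=
    ⟨(v 0 - 3 * c₀ * d₀ ^ 2) / (5 * e₀ ^ 4), by field_simp; ring⟩
  let F : (ℝ × ℝ) × (ℝ × ℝ × ℝ × ℝ) → ℝ × ℝ × ℝ × ℝ := fun q =>
    (q.2.1 ^ 5 + q.1.1 * q.2.2.2.1 ^ 3 - u q.1,
      q.2.2.1 ^ 3 + 10 * q.1.1 ^ 2 * q.2.1 ^ 2 * q.2.2.2.2 ^ 3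
          + 5 * q.1.1 * q.1.2 * q.2.1 * q.2.2.2.2 ^ 4 + q.1.2 ^ 2 * q.2.2.2.2 ^ 5 - w q.1,
      10 * q.1.1 * q.2.1 ^ 3 * q.2.2.2.2 ^ 2 + 3 * q.2.2.1 ^ 2 * q.2.2.2.1 - r q.1,
      5 * q.2.1 ^ 4 * q.2.2.2.2 + 3 * q.2.2.1 * q.2.2.2.1 ^ 2 - v q.1)
  let q₀ : (ℝ × ℝ) × (ℝ × ℝ × ℝ × ℝ) := (0, (e₀, c₀, d₀, a₀))
  have hF : ContDiffAt ℝ 1 F q₀ := by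
    have hu' : ContDiffAt ℝ 1 (fun q : (ℝ × ℝ) × (ℝ × ℝ × ℝ × ℝ) => u q.1) q₀ :=
      ContDiffAt.comp q₀ hu contDiffAt_fst
    have hv' : ContDiffAt ℝ 1 (fun q : (ℝ × ℝ) × (ℝ × ℝ × ℝ × ℝ) => v q.1) q₀ :=
      ContDiffAt.comp q₀ hv contDiffAt_fst
    have hr' : ContDiffAt ℝ 1 (fun q : (ℝ × ℝ) × (ℝ × ℝ × ℝ × ℝ) => r q.1) q₀ :=
      ContDiffAt.comp q₀ hr contDiffAt_fst
    have hw' : ContDiffAt ℝ 1 (fun q : (ℝ × ℝ) × (ℝ × ℝ × ℝ × ℝ) => w q.1) q₀ :=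
      ContDiffAt.comp q₀ hw contDiffAt_fst
    refine ContDiffAt.prodMk (ContDiffAt.sub ?_ hu') (ContDiffAt.prodMk (ContDiffAt.sub ?_ hw')
      (ContDiffAt.prodMk (ContDiffAt.sub ?_ hr') (ContDiffAt.sub ?_ hv'))) <;> fun_prop
  have hF0 : F q₀ = 0 := by
    simp only [F, q₀, Prod.fst_zero, Prod.snd_zero]
    rw [he₀, hc₀]
    refine Prod.ext ?_ (Prod.ext ?_ (Prod.ext ?_ ?_)) <;> simp [hd₀, ha₀]
  have hM : ∀ s : ℝ × ℝ × ℝ × ℝ, (fderiv ℝ F q₀ ∘L .inr ℝ (ℝ × ℝ) (ℝ × ℝ × ℝ × ℝ)) s =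
      (5 * e₀ ^ 4 * s.1, 3 * c₀ ^ 2 * s.2.1, 6 * c₀ * d₀ * s.2.1 + 3 * c₀ ^ 2 * s.2.2.1,
        20 * e₀ ^ 3 * a₀ * s.1 + 5 * e₀ ^ 4 * s.2.2.2 + 3 * d₀ ^ 2 * s.2.1
          + 6 * c₀ * d₀ * s.2.2.1) := by
    intro s
    have h1 : HasDerivAt (fun t : ℝ => q₀ + t • ((0 : ℝ × ℝ), s)) ((0 : ℝ × ℝ), s) 0 := by
      simpa using ((hasDerivAt_id (0 : ℝ)).smul_const ((0 : ℝ × ℝ), s)).const_add q₀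
    have h2 : HasFDerivAt F (fderiv ℝ F q₀) (q₀ + (0 : ℝ) • ((0 : ℝ × ℝ), s)) := by
      simpa using (hF.differentiableAt (by norm_num)).hasFDerivAt
    refine (h2.comp_hasDerivAt 0 h1).unique ?_
    have hl : ∀ α β : ℝ, HasDerivAt (fun t : ℝ => α + t * β) β 0 := fun α β => by
      simpa using ((hasDerivAt_id (0 : ℝ)).mul_const β).const_add α
    have g1 := hl e₀ s.1
    have g2 := hl c₀ s.2.1
    have g3 := hl d₀ s.2.2.1
    have g4 := hl a₀ s.2.2.2
    have k1 := (g1.pow 5).sub_const (u 0)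
    have k2 := (g2.pow 3).sub_const (w 0)
    have k3 := (((g2.pow 2).const_mul 3).mul g3).sub_const (r 0)
    have k4 := ((((g1.pow 4).const_mul 5).mul g4).add ((g2.const_mul 3).mul (g3.pow 2))).sub_const
      (v 0)
    convert! k1.prodMk (k2.prodMk (k3.prodMk k4)) using 1
    · funext t
      simp [F, q₀]
    · simp
      constructor <;> ring
  have hinj : Function.Injective (fderiv ℝ F q₀ ∘L .inr ℝ (ℝ × ℝ) (ℝ × ℝ × ℝ × ℝ)) := by
    refine (injective_iff_map_eq_zero _).2 fun s hs => ?_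
    rw [hM] at hs
    obtain ⟨s1, s2, s3, s4⟩ := s
    simp only [Prod.mk_eq_zero] at hs ⊢
    obtain ⟨h1, h2, h3, h4⟩ := hs
    have z1 : s1 = 0 := by simpa [he] using h1
    have z2 : s2 = 0 := by simpa [hc] using h2
    subst z1 z2
    have z3 : s3 = 0 := by simpa [hc] using h3
    subst z3
    have z4 : s4 = 0 := by simpa [he] using h4
    exact ⟨rfl, rfl, rfl, z4⟩
  have hinv : (fderiv ℝ F q₀ ∘L .inr ℝ (ℝ × ℝ) (ℝ × ℝ × ℝ × ℝ)).IsInvertible :=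
    ⟨(LinearEquiv.ofInjectiveEndo
      (fderiv ℝ F q₀ ∘L .inr ℝ (ℝ × ℝ) (ℝ × ℝ × ℝ × ℝ)).toLinearMap
      hinj).toContinuousLinearEquiv, ContinuousLinearMap.ext fun _ => rfl⟩
  have hI := hF.contDiffAt_implicitFunction one_ne_zero hinv
  have hI0 := hF.implicitFunction_apply_self one_ne_zero hinv
  have hIe := hF.eventually_apply_implicitFunction one_ne_zero hinv
  set I := hF.implicitFunction one_ne_zero hinv
  rw [hF0] at hIe
  change ContDiffAt ℝ 1 I 0 at hI
  change I 0 = (e₀, c₀, d₀, a₀) at hI0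
  refine ⟨fun p => (I p).1, fun p => (I p).2.1, fun p => (I p).2.2.1, fun p => (I p).2.2.2,
    by fun_prop, by fun_prop, by fun_prop, by fun_prop, by simpa [hI0], by simpa [hI0], ?_⟩
  filter_upwards [hIe] with p hp
  simp only [F, Prod.mk_eq_zero, sub_eq_zero] at hp
  exact hp

lemma hasE8Germ_of_eq {φ u v r w : ℝ × ℝ → ℝ} (hu : ContDiffAt ℝ 1 u 0)
    (hv : ContDiffAt ℝ 1 v 0) (hr : ContDiffAt ℝ 1 r 0) (hw : ContDiffAt ℝ 1 w 0)
    (hu0 : u 0 ≠ 0) (hw0 : w 0 ≠ 0) (hφ : ∀ p : ℝ × ℝ, φ p = p.1 ^ 5 * u p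
      + p.1 ^ 4 * p.2 * v p + p.1 ^ 2 * p.2 ^ 2 * r p + p.2 ^ 3 * w p) : HasE8Germ φ := by
  obtain ⟨e, c, d, a, he, hc, hd, ha, he0, hc0, heq⟩ :=
    exists_solution_coefficients hu hv hr hw hu0 hw0
  let Ψ : ℝ × ℝ → ℝ × ℝ := fun p => (p.1 * e p + p.2 * a p, p.2 * c p + p.1 ^ 2 * d p)
  have hΨ : ContDiffAt ℝ 1 Ψ 0 := by
    refine ContDiffAt.prodMk ?_ ?_ <;> fun_prop
  have hΨ0 : Ψ 0 = 0 := by simp [Ψ]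
  have hM : ∀ s : ℝ × ℝ, fderiv ℝ Ψ 0 s = (s.1 * e 0 + s.2 * a 0, s.2 * c 0) := by
    intro s
    have h1 : HasDerivAt (fun t : ℝ => t • s) s 0 := by
      simpa using (hasDerivAt_id (0 : ℝ)).smul_const s
    have h2 : HasFDerivAt Ψ (fderiv ℝ Ψ 0) ((0 : ℝ) • s) := by
      simpa using (hΨ.differentiableAt one_ne_zero).hasFDerivAt
    refine (h2.comp_hasDerivAt 0 h1).unique ?_
    have hl : ∀ f : ℝ × ℝ → ℝ, ContDiffAt ℝ 1 f 0 → ∃ f', HasDerivAt (fun t : ℝ => f (t • s)) f' 0 :=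
      fun f hf => ⟨_, HasFDerivAt.comp_hasDerivAt (l := f) (l' := fderiv ℝ f 0) 0
        (by simpa using (hf.differentiableAt one_ne_zero).hasFDerivAt) h1⟩
    obtain ⟨e', he'⟩ := hl e he
    obtain ⟨a', ha'⟩ := hl a ha
    obtain ⟨c', hc'⟩ := hl c hc
    obtain ⟨d', hd'⟩ := hl d hd
    have hx : ∀ α : ℝ, HasDerivAt (fun t : ℝ => t * α) α 0 := fun α => by
      simpa using (hasDerivAt_id (0 : ℝ)).mul_const α
    convert! (((hx s.1).mul he').add ((hx s.2).mul ha')).prodMk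
      (((hx s.2).mul hc').add (((hx s.1).pow 2).mul hd')) using 1
    simp
  have hinj : Function.Injective (fderiv ℝ Ψ 0) := by
    refine (injective_iff_map_eq_zero _).2 fun s hs => ?_
    rw [hM] at hs
    obtain ⟨s1, s2⟩ := s
    simp only [Prod.mk_eq_zero] at hs ⊢
    have z2 : s2 = 0 := by simpa [hc0] using hs.2
    subst z2
    exact ⟨by simpa [he0] using hs.1, rfl⟩
  let A : (ℝ × ℝ) ≃L[ℝ] ℝ × ℝ := (LinearEquiv.ofInjectiveEndo
      (fderiv ℝ Ψ 0).toLinearMap hinj).toContinuousLinearEquiv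
  have hA : HasFDerivAt Ψ (A : (ℝ × ℝ) →L[ℝ] ℝ × ℝ) 0 := by
    have : (A : (ℝ × ℝ) →L[ℝ] ℝ × ℝ) = fderiv ℝ Ψ 0 :=
      ContinuousLinearMap.ext fun _ => rfl
    rw [this]
    exact (hΨ.differentiableAt one_ne_zero).hasFDerivAt
  have hs := hΨ.hasStrictFDerivAt' hA one_ne_zero
  have hG := hΨ.to_localInverse hA one_ne_zero
  have hG0 := hΨ.localInverse_apply_image hA one_ne_zero
  have hGd : HasStrictFDerivAt (hΨ.localInverse hA one_ne_zero) _ (Ψ 0) := hs.to_localInverse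
  have hGr : ∀ᶠ y in 𝓝 (Ψ 0), Ψ (hΨ.localInverse hA one_ne_zero y) = y :=
    hs.eventually_right_inverse
  set G := hΨ.localInverse hA one_ne_zero
  rw [hΨ0] at hG hG0 hGd hGr
  refine ⟨G, hG, hG0, ?_, ?_⟩
  · rw [hGd.hasFDerivAt.fderiv]
    exact (LinearEquiv.isUnit_det' A.symm.toLinearEquiv).ne_zero
  · have hc : Filter.Tendsto G (𝓝 0) (𝓝 0) := by
      simpa [ContinuousAt, hG0] using hG.continuousAt
    filter_upwards [hGr, hc.eventually heq] with y hy hp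
    obtain ⟨h1, h2, h3, h4⟩ := hp
    rw [hφ, ← h1, ← h2, ← h3, ← h4, ← hy, hy]
    conv_rhs => rw [← hy]
    simp only [Ψ]
    ring

/-- Sufficiency in adapted coordinates. -/
lemma hasE8Germ_of_taylorCoeff {φ : ℝ × ℝ → ℝ} (hφ : ContDiff ℝ 8 φ)
    (h2 : ∀ i j, i + j ≤ 2 → taylorCoeff φ i j = 0) (h30 : taylorCoeff φ 3 0 = 0)
    (h21 : taylorCoeff φ 2 1 = 0) (h12 : taylorCoeff φ 1 2 = 0) (h03 : taylorCoeff φ 0 3 ≠ 0)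
    (h40 : taylorCoeff φ 4 0 = 0) (h31 : taylorCoeff φ 3 1 = 0) (h50 : taylorCoeff φ 5 0 ≠ 0) :
    HasE8Germ φ := by
  obtain ⟨h, hh, hexp⟩ := exists_taylor_six hφ
  have hh' : ∀ j, ContDiff ℝ 1 (h j) := fun j => (hh j).of_le (by norm_num)
  refine hasE8Germ_of_eq (u := fun p => taylorCoeff φ 5 0 + p.1 * h 0 p + p.2 * h 1 p)
    (v := fun p => taylorCoeff φ 4 1)
    (r := fun p => taylorCoeff φ 2 2 + taylorCoeff φ 3 2 * p.1 + p.1 ^ 2 * h 2 p)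
    (w := fun p => taylorCoeff φ 0 3 + taylorCoeff φ 1 3 * p.1 + taylorCoeff φ 0 4 * p.2
      + taylorCoeff φ 2 3 * p.1 ^ 2 + taylorCoeff φ 1 4 * p.1 * p.2 + taylorCoeff φ 0 5 * p.2 ^ 2
      + p.1 ^ 3 * h 3 p + p.1 ^ 2 * p.2 * h 4 p + p.1 * p.2 ^ 2 * h 5 p + p.2 ^ 3 * h 6 p)
    ?_ ?_ ?_ ?_ ?_ ?_ ?_
  any_goals refine ContDiff.contDiffAt ?_; fun_prop
  · simpa
  · simpa
  · rintro ⟨x, y⟩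
    rw [hexp]
    simp only [Finset.sum_range_succ, Finset.sum_range_zero]
    norm_num
    rw [h2 0 0 (by norm_num), h2 0 1 (by norm_num), h2 1 0 (by norm_num), h2 1 1 (by norm_num),
      h2 2 0 (by norm_num), h2 0 2 (by norm_num), h30, h21, h12, h40, h31]
    ring

lemma exists_fderiv_expansion {φ : ℝ × ℝ → ℝ} (hφ : ContDiff ℝ 8 φ)
    (h2 : ∀ i j, i + j ≤ 2 → taylorCoeff φ i j = 0) :
    ∃ ρ₁ ρ₂ : ℝ × ℝ × ℝ → ℝ, Continuous ρ₁ ∧ Continuous ρ₂ ∧ ∀ t x y : ℝ,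
      fderiv ℝ φ (t * x, t * y) (1, 0) =
        t ^ 2 * (3 * taylorCoeff φ 3 0 * x ^ 2 + 2 * taylorCoeff φ 2 1 * x * y
          + taylorCoeff φ 1 2 * y ^ 2)
        + t ^ 3 * (4 * taylorCoeff φ 4 0 * x ^ 3 + 3 * taylorCoeff φ 3 1 * x ^ 2 * y
          + 2 * taylorCoeff φ 2 2 * x * y ^ 2 + taylorCoeff φ 1 3 * y ^ 3)
        + t ^ 4 * (5 * taylorCoeff φ 5 0 * x ^ 4 + y * (4 * taylorCoeff φ 4 1 * x ^ 3
          + 3 * taylorCoeff φ 3 2 * x ^ 2 * y + 2 * taylorCoeff φ 2 3 * x * y ^ 2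
          + taylorCoeff φ 1 4 * y ^ 3))
        + t ^ 5 * ρ₁ (t, x, y) ∧
      fderiv ℝ φ (t * x, t * y) (0, 1) =
        t ^ 2 * (taylorCoeff φ 2 1 * x ^ 2 + 2 * taylorCoeff φ 1 2 * x * y
          + 3 * taylorCoeff φ 0 3 * y ^ 2)
        + t ^ 3 * (taylorCoeff φ 3 1 * x ^ 3 + y * (2 * taylorCoeff φ 2 2 * x ^ 2
          + 3 * taylorCoeff φ 1 3 * x * y + 4 * taylorCoeff φ 0 4 * y ^ 2))
        + t ^ 4 * ρ₂ (t, x, y) := by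
  obtain ⟨h, hh, hexp⟩ := exists_taylor_six hφ
  have hhd : ∀ j z, HasFDerivAt (h j) (fderiv ℝ (h j) z) z := fun j z =>
    ((hh j).differentiable (by norm_num) z).hasFDerivAt
  have hφd : ∀ z, HasFDerivAt φ (fderiv ℝ φ z) z := fun z =>
    (hφ.differentiable (by norm_num) z).hasFDerivAt
  have hc : ∀ j, Continuous (fderiv ℝ (h j)) := fun j => (hh j).continuous_fderiv (by norm_num)
  have hc' : ∀ j, Continuous (h j) := fun j => (hh j).continuous
  have l1 : ∀ x y : ℝ, HasDerivAt (fun s : ℝ => (s, y)) ((1 : ℝ), (0 : ℝ)) x := fun x y =>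
    (hasDerivAt_id x).prodMk (hasDerivAt_const x y)
  have l2 : ∀ x y : ℝ, HasDerivAt (fun s : ℝ => (x, s)) ((0 : ℝ), (1 : ℝ)) y := fun x y =>
    (hasDerivAt_const y x).prodMk (hasDerivAt_id y)
  have d1 : ∀ x y : ℝ, fderiv ℝ φ (x, y) (1, 0) =
      ∑ j ∈ Finset.range 6, ∑ i ∈ Finset.range (6 - j),
          taylorCoeff φ i j * (i * x ^ (i - 1)) * y ^ j
        + ∑ j ∈ Finset.range 7, (((6 - j : ℕ) : ℝ) * x ^ (6 - j - 1) * y ^ j * h j (x, y)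
          + x ^ (6 - j) * y ^ j * fderiv ℝ (h j) (x, y) (1, 0)) := by
    intro x y
    refine ((hφd (x, y)).comp_hasDerivAt x (l1 x y)).unique ?_
    have : (φ ∘ fun s : ℝ => (s, y)) = fun s => _ := funext fun s => hexp s y
    rw [this]
    refine HasDerivAt.add (HasDerivAt.fun_sum fun j _ => HasDerivAt.fun_sum fun i _ => ?_)
      (HasDerivAt.fun_sum fun j _ => ?_)
    · exact ((hasDerivAt_pow i x).const_mul _).mul_const _
    · exact ((hasDerivAt_pow (6 - j) x).mul_const _).mul
        ((hhd j (x, y)).comp_hasDerivAt x (l1 x y))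
  have d2 : ∀ x y : ℝ, fderiv ℝ φ (x, y) (0, 1) =
      ∑ j ∈ Finset.range 6, ∑ i ∈ Finset.range (6 - j),
          taylorCoeff φ i j * x ^ i * (j * y ^ (j - 1))
        + ∑ j ∈ Finset.range 7, (x ^ (6 - j) * (j * y ^ (j - 1)) * h j (x, y)
          + x ^ (6 - j) * y ^ j * fderiv ℝ (h j) (x, y) (0, 1)) := by
    intro x y
    refine ((hφd (x, y)).comp_hasDerivAt y (l2 x y)).unique ?_
    have : (φ ∘ fun s : ℝ => (x, s)) = fun s => _ := funext fun s => hexp x s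
    rw [this]
    refine HasDerivAt.add (HasDerivAt.fun_sum fun j _ => HasDerivAt.fun_sum fun i _ => ?_)
      (HasDerivAt.fun_sum fun j _ => ?_)
    · exact (hasDerivAt_pow j y).const_mul _
    · exact ((hasDerivAt_pow j y).const_mul _).mul
        ((hhd j (x, y)).comp_hasDerivAt y (l2 x y))
  refine ⟨fun q => ∑ j ∈ Finset.range 7,
      (((6 - j : ℕ) : ℝ) * q.2.1 ^ (6 - j - 1) * q.2.2 ^ j * h j (q.1 * q.2.1, q.1 * q.2.2)
        + q.1 * (q.2.1 ^ (6 - j) * q.2.2 ^ j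
          * fderiv ℝ (h j) (q.1 * q.2.1, q.1 * q.2.2) (1, 0))),
    fun q => taylorCoeff φ 4 1 * q.2.1 ^ 4 + 2 * taylorCoeff φ 3 2 * q.2.1 ^ 3 * q.2.2
      + 3 * taylorCoeff φ 2 3 * q.2.1 ^ 2 * q.2.2 ^ 2
      + 4 * taylorCoeff φ 1 4 * q.2.1 * q.2.2 ^ 3 + 5 * taylorCoeff φ 0 5 * q.2.2 ^ 4
      + q.1 * ∑ j ∈ Finset.range 7,
      (q.2.1 ^ (6 - j) * (j * q.2.2 ^ (j - 1)) * h j (q.1 * q.2.1, q.1 * q.2.2)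
        + q.1 * (q.2.1 ^ (6 - j) * q.2.2 ^ j
          * fderiv ℝ (h j) (q.1 * q.2.1, q.1 * q.2.2) (0, 1))), ?_, ?_, fun t x y => ⟨?_, ?_⟩⟩
  · fun_prop
  · fun_prop
  · rw [d1]
    simp only [Finset.sum_range_succ, Finset.sum_range_zero]
    norm_num
    rw [h2 1 0 (by norm_num), h2 1 1 (by norm_num), h2 2 0 (by norm_num)]
    ring
  · rw [d2]
    simp only [Finset.sum_range_succ, Finset.sum_range_zero]
    norm_num
    rw [h2 0 1 (by norm_num), h2 1 1 (by norm_num), h2 0 2 (by norm_num)]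
    ring

open Filter in
lemma exists_fderiv_along {φ : ℝ × ℝ → ℝ} (hφ : ContDiff ℝ 8 φ) {ψ : ℝ × ℝ → ℝ × ℝ}
    (hψ : ContDiffAt ℝ 1 ψ 0) (hψ0 : ψ 0 = 0)
    (hid : fderiv ℝ ψ 0 = ContinuousLinearMap.id ℝ (ℝ × ℝ))
    (heq : ∀ᶠ y in 𝓝 (0 : ℝ × ℝ), φ (ψ y) = y.1 ^ 5 + y.2 ^ 3) (z : ℝ × ℝ) :
    ∃ x y a b c d : ℝ → ℝ, Tendsto x (𝓝[≠] 0) (𝓝 z.1) ∧ Tendsto y (𝓝[≠] 0) (𝓝 z.2) ∧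
      Tendsto a (𝓝[≠] 0) (𝓝 1) ∧ Tendsto b (𝓝[≠] 0) (𝓝 0) ∧ Tendsto c (𝓝[≠] 0) (𝓝 0) ∧
      Tendsto d (𝓝[≠] 0) (𝓝 1) ∧ ∀ᶠ t in 𝓝[≠] 0,
        fderiv ℝ φ (t * x t, t * y t) (1, 0) = 5 * t ^ 4 * z.1 ^ 4 * a t - 3 * t ^ 2 * z.2 ^ 2 * b t ∧
        fderiv ℝ φ (t * x t, t * y t) (0, 1)
          = 3 * t ^ 2 * z.2 ^ 2 * d t - 5 * t ^ 4 * z.1 ^ 4 * c t := by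
  have hφd : ∀ z, HasFDerivAt φ (fderiv ℝ φ z) z := fun z =>
    (hφ.differentiable (by norm_num) z).hasFDerivAt
  have hline : HasDerivAt (fun t : ℝ => t • z) z 0 := by
    simpa using (hasDerivAt_id (0 : ℝ)).smul_const z
  have hlim : Tendsto (fun t : ℝ => t • z) (𝓝[≠] 0) (𝓝 0) := by
    have := hline.continuousAt.tendsto
    rw [zero_smul] at this
    exact this.mono_left nhdsWithin_le_nhds
  have hm : Tendsto (fun t : ℝ => t⁻¹ • ψ (t • z)) (𝓝[≠] 0) (𝓝 z) := by
    have h1 : HasFDerivAt ψ (ContinuousLinearMap.id ℝ (ℝ × ℝ)) ((0 : ℝ) • z) := by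
      rw [zero_smul, ← hid]
      exact (hψ.differentiableAt one_ne_zero).hasFDerivAt
    have h2 := hasDerivAt_iff_tendsto_slope_zero.1 (h1.comp_hasDerivAt 0 hline)
    simpa [hψ0] using h2
  have hT : Tendsto (fun t : ℝ => fderiv ℝ ψ (t • z)) (𝓝[≠] 0)
      (𝓝 (ContinuousLinearMap.id ℝ (ℝ × ℝ))) := by
    rw [← hid]
    exact (hψ.continuousAt_fderiv one_ne_zero).tendsto.comp hlim
  have hTs : ∀ s : ℝ × ℝ, Tendsto (fun t : ℝ => fderiv ℝ ψ (t • z) s) (𝓝[≠] 0) (𝓝 s) :=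
    fun s => ((ContinuousLinearMap.apply ℝ (ℝ × ℝ) s).continuous.tendsto _).comp hT
  have hdiff : ∀ᶠ y in 𝓝 (0 : ℝ × ℝ), DifferentiableAt ℝ ψ y :=
    (hψ.eventually (by simp)).mono fun y hy => hy.differentiableAt one_ne_zero
  have hchain : ∀ᶠ y in 𝓝 (0 : ℝ × ℝ), ∀ s : ℝ × ℝ,
      fderiv ℝ φ (ψ y) (fderiv ℝ ψ y s) = 5 * y.1 ^ 4 * s.1 + 3 * y.2 ^ 2 * s.2 := by
    filter_upwards [heq.eventually_nhds, hdiff] with y hy hyd s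
    have e1 : HasFDerivAt (φ ∘ ψ) (fderiv ℝ φ (ψ y) ∘L fderiv ℝ ψ y) y :=
      (hφd (ψ y)).comp y hyd.hasFDerivAt
    have e2 := (((hasFDerivAt_fst (𝕜 := ℝ) (p := y)).pow 5).add
      ((hasFDerivAt_snd (𝕜 := ℝ) (p := y)).pow 3)).congr_of_eventuallyEq hy
    have := congrArg (fun l : (ℝ × ℝ) →L[ℝ] ℝ => l s) (e1.unique e2)
    simpa using this
  let T₁ : ℝ → ℝ × ℝ := fun t => fderiv ℝ ψ (t • z) (1, 0)
  let T₂ : ℝ → ℝ × ℝ := fun t => fderiv ℝ ψ (t • z) (0, 1)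
  have t11 : Tendsto (fun t => (T₁ t).1) (𝓝[≠] 0) (𝓝 1) := (hTs (1, 0)).fst_nhds
  have t21 : Tendsto (fun t => (T₁ t).2) (𝓝[≠] 0) (𝓝 0) := (hTs (1, 0)).snd_nhds
  have t12 : Tendsto (fun t => (T₂ t).1) (𝓝[≠] 0) (𝓝 0) := (hTs (0, 1)).fst_nhds
  have t22 : Tendsto (fun t => (T₂ t).2) (𝓝[≠] 0) (𝓝 1) := (hTs (0, 1)).snd_nhds
  have hD : Tendsto (fun t => (T₁ t).1 * (T₂ t).2 - (T₂ t).1 * (T₁ t).2) (𝓝[≠] 0) (𝓝 1) := by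
    simpa using (t11.mul t22).sub (t12.mul t21)
  set D : ℝ → ℝ := fun t => (T₁ t).1 * (T₂ t).2 - (T₂ t).1 * (T₁ t).2 with hDdef
  refine ⟨fun t => (t⁻¹ • ψ (t • z)).1, fun t => (t⁻¹ • ψ (t • z)).2, fun t => (T₂ t).2 / D t,
    fun t => (T₁ t).2 / D t, fun t => (T₂ t).1 / D t, fun t => (T₁ t).1 / D t, hm.fst_nhds,
    hm.snd_nhds, ?_, ?_, ?_, ?_, ?_⟩
  · have := t22.div hD one_ne_zero
    rwa [div_one] at this
  · have := t21.div hD one_ne_zero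
    rwa [zero_div] at this
  · have := t12.div hD one_ne_zero
    rwa [zero_div] at this
  · have := t11.div hD one_ne_zero
    rwa [div_one] at this
  · filter_upwards [hlim.eventually hchain, hD.eventually_ne one_ne_zero, self_mem_nhdsWithin]
      with t ht hDt ht0
    have hpt : (t * (t⁻¹ • ψ (t • z)).1, t * (t⁻¹ • ψ (t • z)).2) = ψ (t • z) := by
      have ht0 : t ≠ 0 := ht0
      ext <;> simp [ht0]
    rw [hpt]
    have hlin : ∀ s : ℝ × ℝ, fderiv ℝ φ (ψ (t • z)) s
        = fderiv ℝ φ (ψ (t • z)) (1, 0) * s.1 + fderiv ℝ φ (ψ (t • z)) (0, 1) * s.2 := by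
      intro s
      have : s = s.1 • ((1 : ℝ), (0 : ℝ)) + s.2 • ((0 : ℝ), (1 : ℝ)) := by ext <;> simp
      conv_lhs => rw [this]
      rw [map_add, map_smul, map_smul, smul_eq_mul, smul_eq_mul]
      ring
    have e1 := (hlin (T₁ t)).symm.trans (ht (1, 0))
    have e2 := (hlin (T₂ t)).symm.trans (ht (0, 1))
    simp only [Prod.smul_fst, Prod.smul_snd, smul_eq_mul] at e1 e2
    simp only [mul_div_assoc', ← sub_div]
    rw [eq_div_iff hDt, eq_div_iff hDt, hDdef]
    constructor
    · linear_combination (T₂ t).2 * e1 - (T₁ t).2 * e2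
    · linear_combination (T₁ t).1 * e2 - (T₂ t).1 * e1

open Filter in
/-- Necessity in adapted coordinates. -/
lemma taylorCoeff_of_comp_eq {φ : ℝ × ℝ → ℝ} (hφ : ContDiff ℝ 8 φ)
    (h2 : ∀ i j, i + j ≤ 2 → taylorCoeff φ i j = 0) {ψ : ℝ × ℝ → ℝ × ℝ}
    (hψ : ContDiffAt ℝ 1 ψ 0) (hψ0 : ψ 0 = 0)
    (hid : fderiv ℝ ψ 0 = ContinuousLinearMap.id ℝ (ℝ × ℝ))
    (heq : ∀ᶠ y in 𝓝 (0 : ℝ × ℝ), φ (ψ y) = y.1 ^ 5 + y.2 ^ 3) :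
    taylorCoeff φ 3 0 = 0 ∧ taylorCoeff φ 2 1 = 0 ∧ taylorCoeff φ 1 2 = 0 ∧
      taylorCoeff φ 0 3 = 1 ∧ taylorCoeff φ 4 0 = 0 ∧ taylorCoeff φ 3 1 = 0 ∧
      taylorCoeff φ 5 0 = 1 := by
  obtain ⟨ρ₁, ρ₂, hρ₁, hρ₂, hexp⟩ := exists_fderiv_expansion hφ h2
  have hid0 : Tendsto (fun t : ℝ => t) (𝓝[≠] 0) (𝓝 0) := tendsto_id.mono_left nhdsWithin_le_nhds
  have hne : ∀ᶠ t : ℝ in 𝓝[≠] 0, t ≠ 0 := self_mem_nhdsWithin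
  have cubic : ∀ z : ℝ × ℝ, 3 * taylorCoeff φ 3 0 * z.1 ^ 2 + 2 * taylorCoeff φ 2 1 * z.1 * z.2
      + taylorCoeff φ 1 2 * z.2 ^ 2 = 0 ∧ taylorCoeff φ 2 1 * z.1 ^ 2
      + 2 * taylorCoeff φ 1 2 * z.1 * z.2 + 3 * taylorCoeff φ 0 3 * z.2 ^ 2 = 3 * z.2 ^ 2 := by
    intro z
    obtain ⟨x, y, a, b, c, d, hx, hy, ha, hb, hc, hd, hfd⟩ :=
      exists_fderiv_along hφ hψ hψ0 hid heq z
    have hr₁ := (hρ₁.tendsto (0, z.1, z.2)).comp (hid0.prodMk_nhds (hx.prodMk_nhds hy))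
    have hr₂ := (hρ₂.tendsto (0, z.1, z.2)).comp (hid0.prodMk_nhds (hx.prodMk_nhds hy))
    have hall := hid0.prodMk_nhds (hx.prodMk_nhds (hy.prodMk_nhds (ha.prodMk_nhds
      (hb.prodMk_nhds (hc.prodMk_nhds (hd.prodMk_nhds (hr₁.prodMk_nhds hr₂)))))))
    have lim : ∀ f : ℝ × ℝ × ℝ × ℝ × ℝ × ℝ × ℝ × ℝ × ℝ → ℝ, Continuous f →
        (∀ᶠ t in 𝓝[≠] 0, f (t, x t, y t, a t, b t, c t, d t, ρ₁ (t, x t, y t),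
          ρ₂ (t, x t, y t)) = 0) →
        f (0, z.1, z.2, 1, 0, 0, 1, ρ₁ (0, z.1, z.2), ρ₂ (0, z.1, z.2)) = 0 := fun f hf h =>
      tendsto_nhds_unique ((hf.tendsto _).comp hall) (tendsto_const_nhds.congr' (h.mono
        fun t ht => ht.symm))
    constructor
    · have := lim (fun (t, x, y, a, b, c, d, r, s) =>
        3 * taylorCoeff φ 3 0 * x ^ 2 + 2 * taylorCoeff φ 2 1 * x * y
          + taylorCoeff φ 1 2 * y ^ 2
        + t * (4 * taylorCoeff φ 4 0 * x ^ 3 + 3 * taylorCoeff φ 3 1 * x ^ 2 * y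
          + 2 * taylorCoeff φ 2 2 * x * y ^ 2 + taylorCoeff φ 1 3 * y ^ 3)
        + t ^ 2 * (5 * taylorCoeff φ 5 0 * x ^ 4 + y * (4 * taylorCoeff φ 4 1 * x ^ 3
          + 3 * taylorCoeff φ 3 2 * x ^ 2 * y + 2 * taylorCoeff φ 2 3 * x * y ^ 2
          + taylorCoeff φ 1 4 * y ^ 3))
        + t ^ 3 * r - (5 * t ^ 2 * z.1 ^ 4 * a - 3 * z.2 ^ 2 * b)) (by fun_prop) (by
          filter_upwards [hfd, hne] with t ht ht0
          refine (mul_eq_zero_iff_left (pow_ne_zero 2 ht0)).1 ?_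
          linear_combination ht.1 - (hexp t (x t) (y t)).1)
      linear_combination this
    · have := lim (fun (t, x, y, a, b, c, d, r, s) =>
        taylorCoeff φ 2 1 * x ^ 2 + 2 * taylorCoeff φ 1 2 * x * y
          + 3 * taylorCoeff φ 0 3 * y ^ 2
        + t * (taylorCoeff φ 3 1 * x ^ 3 + y * (2 * taylorCoeff φ 2 2 * x ^ 2
          + 3 * taylorCoeff φ 1 3 * x * y + 4 * taylorCoeff φ 0 4 * y ^ 2))
        + t ^ 2 * s - (3 * z.2 ^ 2 * d - 5 * t ^ 2 * z.1 ^ 4 * c)) (by fun_prop) (by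
          filter_upwards [hfd, hne] with t ht ht0
          refine (mul_eq_zero_iff_left (pow_ne_zero 2 ht0)).1 ?_
          linear_combination ht.2 - (hexp t (x t) (y t)).2)
      linear_combination this
  have h10 := cubic (1, 0)
  have h01 := cubic (0, 1)
  norm_num at h10 h01
  obtain ⟨h30, h21⟩ := h10
  obtain ⟨h12, h03⟩ := h01
  obtain ⟨x, y, a, b, c, d, hx, hy, ha, hb, hc, hd, hfd⟩ :=
    exists_fderiv_along hφ hψ hψ0 hid heq (1, 0)
  simp only at hx hy
  have hr₁ : Tendsto (fun t => ρ₁ (t, x t, y t)) (𝓝[≠] 0) (𝓝 (ρ₁ (0, 1, 0))) :=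
    (hρ₁.tendsto (0, 1, 0)).comp (hid0.prodMk_nhds (hx.prodMk_nhds hy))
  have hr₂ : Tendsto (fun t => ρ₂ (t, x t, y t)) (𝓝[≠] 0) (𝓝 (ρ₂ (0, 1, 0))) :=
    (hρ₂.tendsto (0, 1, 0)).comp (hid0.prodMk_nhds (hx.prodMk_nhds hy))
  have hq : Tendsto (fun t => y t ^ 2 / t) (𝓝[≠] 0) (𝓝 (-taylorCoeff φ 3 1 / 3)) := by
    have hall := hid0.prodMk_nhds (hx.prodMk_nhds (hy.prodMk_nhds (hc.prodMk_nhds hr₂)))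
    have hf : Continuous fun ((t, x, y, c, s) : ℝ × ℝ × ℝ × ℝ × ℝ) =>
        -(taylorCoeff φ 3 1 * x ^ 3 + y * (2 * taylorCoeff φ 2 2 * x ^ 2
          + 3 * taylorCoeff φ 1 3 * x * y + 4 * taylorCoeff φ 0 4 * y ^ 2)
          + t * s + 5 * t * c) / 3 := by fun_prop
    have := (hf.tendsto _).comp hall
    simp only [one_pow, mul_one, zero_mul, mul_zero, add_zero] at this
    refine this.congr' ?_
    filter_upwards [hfd, hne] with t ht ht0
    have e := ht.2.symm.trans (hexp t (x t) (y t)).2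
    simp only [Function.comp]
    rw [eq_div_iff ht0]
    refine mul_left_cancel₀ (pow_ne_zero 2 ht0) ?_
    simp only [h21, h12, h03] at e
    linear_combination e / 3
  have h31 : taylorCoeff φ 3 1 = 0 := by
    have hpos := ge_of_tendsto (hq.mono_left (nhdsWithin_mono (0 : ℝ)
      (show Ioi (0 : ℝ) ⊆ {0}ᶜ from fun t ht => ne_of_gt ht))) (b := 0) (by
        filter_upwards [self_mem_nhdsWithin] with t ht
        exact div_nonneg (sq_nonneg _) (le_of_lt ht))
    have hneg := le_of_tendsto (hq.mono_left (nhdsWithin_mono (0 : ℝ)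
      (show Iio (0 : ℝ) ⊆ {0}ᶜ from fun t ht => ne_of_lt ht))) (b := 0) (by
        filter_upwards [self_mem_nhdsWithin] with t ht
        exact div_nonpos_of_nonneg_of_nonpos (sq_nonneg _) (le_of_lt ht))
    linarith
  rw [h31, neg_zero, zero_div] at hq
  have hall := hid0.prodMk_nhds (hx.prodMk_nhds (hy.prodMk_nhds (ha.prodMk_nhds
    (hq.prodMk_nhds hr₁))))
  have lim : ∀ f : ℝ × ℝ × ℝ × ℝ × ℝ × ℝ → ℝ, Continuous f →
      (∀ᶠ t in 𝓝[≠] 0, f (t, x t, y t, a t, y t ^ 2 / t, ρ₁ (t, x t, y t)) = 0) →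
      f (0, 1, 0, 1, 0, ρ₁ (0, 1, 0)) = 0 := fun f hf h =>
    tendsto_nhds_unique ((hf.tendsto _).comp hall) (tendsto_const_nhds.congr' (h.mono
      fun t ht => ht.symm))
  have h40 : taylorCoeff φ 4 0 = 0 := by
    have := lim (fun (t, x, y, a, w, r) =>
      4 * taylorCoeff φ 4 0 * x ^ 3 + 2 * taylorCoeff φ 2 2 * x * y ^ 2
        + taylorCoeff φ 1 3 * y ^ 3
        + t * (5 * taylorCoeff φ 5 0 * x ^ 4 + y * (4 * taylorCoeff φ 4 1 * x ^ 3
          + 3 * taylorCoeff φ 3 2 * x ^ 2 * y + 2 * taylorCoeff φ 2 3 * x * y ^ 2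
          + taylorCoeff φ 1 4 * y ^ 3))
        + t ^ 2 * r - 5 * t * a) (by fun_prop) (by
          filter_upwards [hfd, hne] with t ht ht0
          refine (mul_eq_zero_iff_left (pow_ne_zero 3 ht0)).1 ?_
          have e := ht.1.symm.trans (hexp t (x t) (y t)).1
          simp only [h30, h21, h12, h31] at e
          linear_combination -e)
    linear_combination this / 4
  have h50 : taylorCoeff φ 5 0 = 1 := by
    have := lim (fun (t, x, y, a, w, r) =>
      2 * taylorCoeff φ 2 2 * x * w + taylorCoeff φ 1 3 * y * w
        + (5 * taylorCoeff φ 5 0 * x ^ 4 + y * (4 * taylorCoeff φ 4 1 * x ^ 3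
          + 3 * taylorCoeff φ 3 2 * x ^ 2 * y + 2 * taylorCoeff φ 2 3 * x * y ^ 2
          + taylorCoeff φ 1 4 * y ^ 3))
        + t * r - 5 * a) (by fun_prop) (by
          filter_upwards [hfd, hne] with t ht ht0
          refine (mul_eq_zero_iff_left (pow_ne_zero 4 ht0)).1 ?_
          have e := ht.1.symm.trans (hexp t (x t) (y t)).1
          have hw : y t ^ 2 / t * t = y t ^ 2 := div_mul_cancel₀ _ ht0
          simp only [h30, h21, h12, h31, h40] at e
          linear_combination -e + t ^ 3 * (2 * taylorCoeff φ 2 2 * x t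
            + taylorCoeff φ 1 3 * y t) * hw)
    linear_combination this / 5
  exact ⟨h30, h21, h12, h03, h40, h31, h50⟩

lemma taylorCoeff_comp_eq_zero {φ : ℝ × ℝ → ℝ} (hφ : ContDiff ℝ 8 φ)
    (h2 : ∀ i j, i + j ≤ 2 → taylorCoeff φ i j = 0) (L : ℝ × ℝ →L[ℝ] ℝ × ℝ) (i j : ℕ)
    (hij : i + j ≤ 2) : taylorCoeff (φ ∘ L) i j = 0 := by
  have h : ∀ k ≤ 2, ∀ z, homPart (φ ∘ L) k z = 0 := by
    intro k hk z
    rw [homPart_comp hφ L (by omega), homPart]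
    refine Finset.sum_eq_zero fun i hi => ?_
    rw [h2 i (k - i) (by have := Finset.mem_range.1 hi; omega), zero_mul, zero_mul]
  have e0 := h 0 (by norm_num) (1, 1)
  have e1 := h 1 (by norm_num) (1, 0)
  have e2 := h 1 (by norm_num) (0, 1)
  have e3 := h 2 (by norm_num) (1, 0)
  have e4 := h 2 (by norm_num) (0, 1)
  have e5 := h 2 (by norm_num) (1, 1)
  simp only [homPart, Finset.sum_range_succ, Finset.sum_range_zero] at e0 e1 e2 e3 e4 e5
  norm_num at e0 e1 e2 e3 e4 e5
  rw [e3, e4] at e5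
  norm_num at e5
  obtain ⟨rfl, rfl⟩ | ⟨rfl, rfl⟩ | ⟨rfl, rfl⟩ | ⟨rfl, rfl⟩ | ⟨rfl, rfl⟩ | ⟨rfl, rfl⟩ :
    (i = 0 ∧ j = 0) ∨ (i = 1 ∧ j = 0) ∨ (i = 0 ∧ j = 1) ∨ (i = 2 ∧ j = 0) ∨ (i = 0 ∧ j = 2) ∨
      (i = 1 ∧ j = 1) := by omega
  all_goals assumption

/-- A function with an `E₈` singularity agrees to the relevant order with its normal form in
suitable linear coordinates. -/
lemma HasE8Germ.exists_homPart_eq {φ : ℝ × ℝ → ℝ} (hφ : ContDiff ℝ 8 φ)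
    (h2 : ∀ i j, i + j ≤ 2 → taylorCoeff φ i j = 0) (h : HasE8Germ φ) :
    ∃ (M : (ℝ × ℝ) ≃L[ℝ] ℝ × ℝ) (r s t : ℝ), ∀ z,
      homPart φ 3 z = (M z).2 ^ 3 ∧
      homPart φ 4 z = (M z).2 ^ 2 * (r * (M z).1 ^ 2 + s * (M z).1 * (M z).2 + t * (M z).2 ^ 2) ∧
      ((M z).2 = 0 → homPart φ 5 z = (M z).1 ^ 5) := by
  obtain ⟨ψ, hψ, hψ0, hdet, heq⟩ := h
  let A : (ℝ × ℝ) ≃L[ℝ] ℝ × ℝ := (LinearEquiv.ofIsUnitDet (v := Module.finBasis ℝ (ℝ × ℝ))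
    (v' := Module.finBasis ℝ (ℝ × ℝ)) (f := (fderiv ℝ ψ 0 : (ℝ × ℝ) →ₗ[ℝ] ℝ × ℝ))
    (by rw [LinearMap.det_toMatrix]; exact hdet.isUnit)).toContinuousLinearEquiv
  have hA : ∀ s, A s = fderiv ℝ ψ 0 s := fun s => rfl
  have hAc : (A : ℝ × ℝ →L[ℝ] ℝ × ℝ) = fderiv ℝ ψ 0 := by
    ext <;> simp [hA]
  have hφ' : ContDiff ℝ 8 (φ ∘ (A : ℝ × ℝ →L[ℝ] ℝ × ℝ)) :=
    hφ.comp (A : ℝ × ℝ →L[ℝ] ℝ × ℝ).contDiff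
  obtain ⟨h30, h21, h12, h03, h40, h31, h50⟩ := taylorCoeff_of_comp_eq hφ'
    (taylorCoeff_comp_eq_zero hφ h2 _) (ψ := A.symm ∘ ψ)
    (A.symm.contDiff.contDiffAt.comp 0 hψ) (by simp [hψ0]) (by
      rw [ContinuousLinearEquiv.comp_fderiv, ← hAc]
      ext <;> simp) (by
      filter_upwards [heq] with y hy
      simpa using hy)
  have hM : ∀ k < 6, ∀ z, homPart φ k z
      = homPart (φ ∘ (A : ℝ × ℝ →L[ℝ] ℝ × ℝ)) k (A.symm z) := fun k hk z => by
    rw [homPart_comp hφ _ hk]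
    simp
  generalize φ ∘ (A : ℝ × ℝ →L[ℝ] ℝ × ℝ) = φ' at *
  refine ⟨A.symm, taylorCoeff φ' 2 2, taylorCoeff φ' 1 3, taylorCoeff φ' 0 4,
    fun z => ⟨?_, ?_, fun hz => ?_⟩⟩
  · rw [hM 3 (by norm_num)]
    simp only [homPart, Finset.sum_range_succ, Finset.sum_range_zero]
    norm_num
    rw [h30, h21, h12, h03]
    ring
  · rw [hM 4 (by norm_num)]
    simp only [homPart, Finset.sum_range_succ, Finset.sum_range_zero]
    norm_num
    rw [h40, h31]
    ring
  · rw [hM 5 (by norm_num)]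
    simp only [homPart, Finset.sum_range_succ, Finset.sum_range_zero, hz]
    norm_num
    rw [h50]
    ring

/-- Sufficiency of the conditions on the homogeneous parts, in arbitrary linear coordinates. -/
lemma hasE8Germ_of_homPart {φ : ℝ × ℝ → ℝ} (hφ : ContDiff ℝ 8 φ)
    (h2 : ∀ i j, i + j ≤ 2 → taylorCoeff φ i j = 0) {c a b : ℝ} (hc : c ≠ 0)
    (hab : (a, b) ≠ (0, 0)) {q : ℝ × ℝ → ℝ} (hq : Continuous q)
    (h3 : ∀ z, homPart φ 3 z = c * (a * z.1 + b * z.2) ^ 3)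
    (h4 : ∀ z, homPart φ 4 z = (a * z.1 + b * z.2) ^ 2 * q z)
    (h5 : ∀ z, z ≠ 0 → ¬(homPart φ 3 z = 0 ∧ homPart φ 5 z = 0)) : HasE8Germ φ := by
  have hn : a ^ 2 + b ^ 2 ≠ 0 := fun h => hab (by
    have ha : a = 0 := by nlinarith [sq_nonneg a, sq_nonneg b]
    have hb : b = 0 := by nlinarith [sq_nonneg a, sq_nonneg b]
    rw [ha, hb])
  let L : (ℝ × ℝ) ≃L[ℝ] ℝ × ℝ := LinearEquiv.toContinuousLinearEquiv
    { toFun := fun z => (b * z.1 + a * z.2, -a * z.1 + b * z.2)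
      map_add' := fun x y => by ext <;> simp <;> ring
      map_smul' := fun r x => by ext <;> simp <;> ring
      invFun := fun z => ((b * z.1 - a * z.2) / (a ^ 2 + b ^ 2), (a * z.1 + b * z.2) / (a ^ 2 + b ^ 2))
      left_inv := fun z => by ext <;> simp <;> field_simp <;> ring
      right_inv := fun z => by ext <;> simp <;> field_simp <;> ring }
  have hL : ∀ z, (L : ℝ × ℝ →L[ℝ] ℝ × ℝ) z = (b * z.1 + a * z.2, -a * z.1 + b * z.2) :=
    fun z => rfl
  rw [← hasE8Germ_comp_iff L]
  change HasE8Germ (φ ∘ (L : ℝ × ℝ →L[ℝ] ℝ × ℝ))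
  set φ' := φ ∘ (L : ℝ × ℝ →L[ℝ] ℝ × ℝ) with hφ'
  have g3 : ∀ z, homPart φ' 3 z = c * (a ^ 2 + b ^ 2) ^ 3 * z.2 ^ 3 := fun z => by
    rw [hφ', homPart_comp hφ _ (by norm_num), h3, hL]
    ring
  have g4 : ∀ z, homPart φ' 4 z
      = (a ^ 2 + b ^ 2) ^ 2 * z.2 ^ 2 * q (b * z.1 + a * z.2, -a * z.1 + b * z.2) := fun z => by
    rw [hφ', homPart_comp hφ _ (by norm_num), h4, hL]
    ring
  have e1 := g3 (1, 0)
  have e2 := g3 (0, 1)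
  have e3 := g3 (1, 1)
  have e4 := g3 (1, -1)
  simp only [homPart, Finset.sum_range_succ, Finset.sum_range_zero] at e1 e2 e3 e4
  norm_num at e1 e2 e3 e4
  have h40 : taylorCoeff φ' 4 0 = 0 := by
    have := g4 (1, 0)
    simp only [homPart, Finset.sum_range_succ, Finset.sum_range_zero] at this
    norm_num at this
    exact this
  have h31 : taylorCoeff φ' 3 1 = 0 := by
    have hev : ∀ t ∈ ({0}ᶜ : Set ℝ), taylorCoeff φ' 3 1 + t * taylorCoeff φ' 2 2
        + t ^ 2 * taylorCoeff φ' 1 3 + t ^ 3 * taylorCoeff φ' 0 4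
        = t * ((a ^ 2 + b ^ 2) ^ 2 * q (b + a * t, -a + b * t)) := by
      intro t ht
      have := g4 (1, t)
      simp only [homPart, Finset.sum_range_succ, Finset.sum_range_zero] at this
      norm_num at this
      refine mul_left_cancel₀ (show t ≠ 0 from ht) ?_
      rw [h40] at this
      linear_combination this
    have := Continuous.ext_on (dense_compl_singleton (0 : ℝ)) (by fun_prop) (by fun_prop) hev
    simpa using congrFun this 0
  refine hasE8Germ_of_taylorCoeff (hφ.comp (L : ℝ × ℝ →L[ℝ] ℝ × ℝ).contDiff)
    (taylorCoeff_comp_eq_zero hφ h2 _) e1 (by linarith) (by linarith) ?_ h40 h31 ?_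
  · rw [e2]
    exact mul_ne_zero hc (pow_ne_zero 3 hn)
  · intro h50
    refine h5 ((L : ℝ × ℝ →L[ℝ] ℝ × ℝ) (1, 0)) ?_ ⟨?_, ?_⟩
    · change L (1, 0) ≠ 0
      simp
    · rw [← homPart_comp hφ _ (by norm_num), ← hφ', g3]
      simp
    · rw [← homPart_comp hφ _ (by norm_num)]
      simp only [homPart, Finset.sum_range_succ, Finset.sum_range_zero]
      norm_num
      exact h50

/-- invariant characterization of `E₈` type singularities for `C⁸` functions:
`φ` has an `E₈` singularity at the origin iff its third Taylor homogeneous part `p₃` is a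
nonzero constant times the cube of a nonzero linear form `ℓ`, the square `ℓ²` divides the
fourth Taylor homogeneous part `p₄`, and `p₃`, `p₅` have no common zero outside the
origin (`Res(p₃,p₅) ≠ 0`). -/
theorem stmt_7 (U : Set (ℝ × ℝ)) (hU : U ∈ nhds (0 : ℝ × ℝ))
    (φ : ℝ × ℝ → ℝ) (hφ : ContDiffOn ℝ 8 φ U) (hφ0 : φ 0 = 0)
    (hcrit : ∀ i j : ℕ, i + j ≤ 2 → mixedPartial φ i j = 0)
    (p3 p4 p5 : MvPolynomial (Fin 2) ℝ)
    (hp3 : p3 = ∑ i ∈ Finset.range 4,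
      C (mixedPartial φ i (3 - i) / (Nat.factorial i * Nat.factorial (3 - i))) *
        X 0 ^ i * X 1 ^ (3 - i))
    (hp4 : p4 = ∑ i ∈ Finset.range 5,
      C (mixedPartial φ i (4 - i) / (Nat.factorial i * Nat.factorial (4 - i))) *
        X 0 ^ i * X 1 ^ (4 - i))
    (hp5 : p5 = ∑ i ∈ Finset.range 6,
      C (mixedPartial φ i (5 - i) / (Nat.factorial i * Nat.factorial (5 - i))) *
        X 0 ^ i * X 1 ^ (5 - i)) :
    HasE8 φ U ↔
      ∃ c : ℝ, c ≠ 0 ∧ ∃ ℓ : MvPolynomial (Fin 2) ℝ,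
        (∃ a b : ℝ, (a, b) ≠ (0, 0) ∧ ℓ = C a * X 0 + C b * X 1) ∧
        p3 = C c * ℓ ^ 3 ∧ ℓ ^ 2 ∣ p4 ∧
        ∀ x : ℝ × ℝ, x ≠ 0 →
          ¬(eval ![x.1, x.2] p3 = 0 ∧ eval ![x.1, x.2] p5 = 0) := by
  obtain ⟨Φ, hΦ, hΦφ⟩ := exists_contDiff_eventuallyEq (n := 8) hU (by exact_mod_cast hφ)
  replace hΦ : ContDiff ℝ 8 Φ := by exact_mod_cast hΦ
  have hm := mixedPartial_congr hΦφ
  have h2 : ∀ i j, i + j ≤ 2 → taylorCoeff Φ i j = 0 := fun i j hij => by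
    rw [taylorCoeff, hm, hcrit i j hij, zero_div]
  have ev3 : ∀ x : ℝ × ℝ, eval ![x.1, x.2] p3 = homPart Φ 3 x := fun x => by
    simp [hp3, homPart, taylorCoeff, hm]
  have ev4 : ∀ x : ℝ × ℝ, eval ![x.1, x.2] p4 = homPart Φ 4 x := fun x => by
    simp [hp4, homPart, taylorCoeff, hm]
  have ev5 : ∀ x : ℝ × ℝ, eval ![x.1, x.2] p5 = homPart Φ 5 x := fun x => by
    simp [hp5, homPart, taylorCoeff, hm]
  have hvec : ∀ v : Fin 2 → ℝ, v = ![v 0, v 1] := fun v => by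
    ext i
    fin_cases i <;> rfl
  rw [hasE8_iff_hasE8Germ hU hΦφ]
  constructor
  · intro h
    obtain ⟨M, r, s, t, hM⟩ := h.exists_homPart_eq hΦ h2
    have hlin : ∀ z : ℝ × ℝ, M z = z.1 • M (1, 0) + z.2 • M (0, 1) := fun z => by
      rw [← map_smul, ← map_smul, ← map_add]
      congr 1
      ext <;> simp
    have hM1 : ∀ z : ℝ × ℝ, (M z).1 = (M (1, 0)).1 * z.1 + (M (0, 1)).1 * z.2 := fun z => by
      rw [hlin]
      simp [mul_comm]
    have hM2 : ∀ z : ℝ × ℝ, (M z).2 = (M (1, 0)).2 * z.1 + (M (0, 1)).2 * z.2 := fun z => by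
      rw [hlin]
      simp [mul_comm]
    refine ⟨1, one_ne_zero, _, ⟨(M (1, 0)).2, (M (0, 1)).2, ?_, rfl⟩, ?_, ?_, ?_⟩
    · intro h0
      have h1 := hM2 (M.symm (0, 1))
      rw [(Prod.mk.inj h0).1, (Prod.mk.inj h0).2] at h1
      simp at h1
    · refine MvPolynomial.funext fun v => ?_
      rw [hvec v, ev3 (v 0, v 1), (hM _).1, hM2]
      simp
    · refine ⟨C r * (C (M (1, 0)).1 * X 0 + C (M (0, 1)).1 * X 1) ^ 2
        + C s * (C (M (1, 0)).1 * X 0 + C (M (0, 1)).1 * X 1)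
          * (C (M (1, 0)).2 * X 0 + C (M (0, 1)).2 * X 1)
        + C t * (C (M (1, 0)).2 * X 0 + C (M (0, 1)).2 * X 1) ^ 2,
        MvPolynomial.funext fun v => ?_⟩
      rw [hvec v, ev4 (v 0, v 1), (hM _).2.1, hM1, hM2]
      simp
    · rintro x hx ⟨hx3, hx5⟩
      rw [ev3, (hM x).1] at hx3
      have hx2 : (M x).2 = 0 := pow_eq_zero_iff (by norm_num) |>.1 hx3
      rw [ev5, (hM x).2.2 hx2] at hx5
      exact hx (M.map_eq_zero_iff.1 (Prod.ext (pow_eq_zero_iff (by norm_num) |>.1 hx5) hx2))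
  · rintro ⟨c, hc, ℓ, ⟨a, b, hab, rfl⟩, h3, ⟨q, h4⟩, h5⟩
    refine hasE8Germ_of_homPart hΦ h2 hc hab (q := fun z => eval ![z.1, z.2] q) ?_ (fun z => ?_)
      (fun z => ?_) fun z hz => ?_
    · refine (MvPolynomial.continuous_eval q).comp (continuous_pi fun i => ?_)
      fin_cases i
      · exact continuous_fst
      · exact continuous_snd
    · rw [← ev3, h3]
      simp
    · rw [← ev4, h4]
      simp
    · rw [← ev3, ← ev5]
      exact h5 z hz
end

section
/- Let φ be a function on a neighborhood of the origin in ℝ² of the form φ(x₁,x₂) = B(x₁,x₂)·x₂³ + B₁(x₁,x₂)·x₂·x₁³, where B and B₁ are functions of class C¹ with B(0,0) ≠ 0 and B₁(0,0) ≠ 0. Then φ has a singularity of type E₇ at the origin; explicitly, the C¹ change of variables z₂ = x₂·(B(x₁,x₂))^{1/3}, z₁ = x₁·(B₁(x₁,x₂)/(B(x₁,x₂))^{1/3})^{1/3} (real cube roots) has nonzero Jacobian determinant at the origin and transforms φ into z₂³ + z₂·z₁³ on a neighborhood of the origin. -/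
open Set

/-- The real cube root, defined for all real `t`. -/
noncomputable def cbrt (t : ℝ) : ℝ := Real.sign t * |t| ^ ((1 : ℝ) / 3)

/-- `φ` (with domain `U`, a neighborhood of the origin) has a singularity of type `E₇`
at the origin. -/
def HasE7 (φ : ℝ × ℝ → ℝ) (U : Set (ℝ × ℝ)) : Prop :=
  ∃ V ∈ nhds (0 : ℝ × ℝ), ∃ ϕ : ℝ × ℝ → ℝ × ℝ,
    ContDiffOn ℝ 1 ϕ V ∧ ϕ 0 = 0 ∧ ϕ '' V ⊆ U ∧
    LinearMap.det ((fderiv ℝ ϕ 0) : (ℝ × ℝ) →ₗ[ℝ] ℝ × ℝ) ≠ 0 ∧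
    ∀ y ∈ V, φ (ϕ y) = y.2 * y.1 ^ 3 + y.2 ^ 3

theorem cbrt_pow_three (t : ℝ) : cbrt t ^ 3 = t := by
  have h : (|t| ^ ((1 : ℝ) / 3)) ^ 3 = |t| := by
    rw [← Real.rpow_natCast, ← Real.rpow_mul (abs_nonneg t)]
    norm_num
  rw [cbrt, mul_pow, h]
  rcases lt_trichotomy t 0 with ht | rfl | ht
  · rw [Real.sign_of_neg ht, abs_of_neg ht]
    ring
  · simp
  · rw [Real.sign_of_pos ht, abs_of_pos ht]
    ring

theorem cbrt_ne_zero {t : ℝ} (ht : t ≠ 0) : cbrt t ≠ 0 := by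
  intro h
  apply ht
  rw [← cbrt_pow_three t, h]
  norm_num

theorem contDiffAt_cbrt {n : WithTop ℕ∞} {t : ℝ} (ht : t ≠ 0) : ContDiffAt ℝ n cbrt t := by
  rcases lt_or_gt_of_ne ht with h | h
  · have h1 : ContDiffAt ℝ n (fun s : ℝ => -(-s) ^ ((1 : ℝ) / 3)) t :=
      (contDiffAt_id.neg.rpow_const_of_ne (neg_ne_zero.mpr ht)).neg
    refine h1.congr_of_eventuallyEq ?_
    filter_upwards [Iio_mem_nhds h] with s hs
    rw [cbrt, Real.sign_of_neg hs, abs_of_neg hs, neg_one_mul]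
  · have h1 : ContDiffAt ℝ n (fun s : ℝ => s ^ ((1 : ℝ) / 3)) t :=
      contDiffAt_id.rpow_const_of_ne ht
    refine h1.congr_of_eventuallyEq ?_
    filter_upwards [Ioi_mem_nhds h] with s hs
    rw [cbrt, Real.sign_of_pos hs, abs_of_pos hs, one_mul]

/-- The derivative at the origin of `x ↦ (x₁ · a x, x₂ · b x)` is `diag (a 0, b 0)`. -/
theorem exists_equiv_hasFDerivAt_mul {a b : ℝ × ℝ → ℝ}
    (ha : DifferentiableAt ℝ a 0) (hb : DifferentiableAt ℝ b 0) (ha0 : a 0 ≠ 0) (hb0 : b 0 ≠ 0) :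
    ∃ e : (ℝ × ℝ) ≃L[ℝ] ℝ × ℝ,
      HasFDerivAt (fun x : ℝ × ℝ => ((x.1 * a x, x.2 * b x) : ℝ × ℝ))
        (e : (ℝ × ℝ) →L[ℝ] ℝ × ℝ) 0 := by
  refine ⟨(ContinuousLinearEquiv.unitsEquivAut ℝ (Units.mk0 _ ha0)).prodCongr
    (ContinuousLinearEquiv.unitsEquivAut ℝ (Units.mk0 _ hb0)), ?_⟩
  have h := (hasFDerivAt_fst (𝕜 := ℝ) (p := (0 : ℝ × ℝ))).mul ha.hasFDerivAt |>.prodMk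
    ((hasFDerivAt_snd (𝕜 := ℝ) (p := (0 : ℝ × ℝ))).mul hb.hasFDerivAt)
  refine h.congr_fderiv ?_
  ext <;> simp

theorem ContinuousLinearEquiv.det_toLinearMap_ne_zero {𝕜 E : Type*} [Field 𝕜]
    [TopologicalSpace E] [AddCommGroup E] [Module 𝕜 E] (e : E ≃L[𝕜] E) :
    LinearMap.det (((e : E →L[𝕜] E)) : E →ₗ[𝕜] E) ≠ 0 :=
  (LinearEquiv.isUnit_det' e.toLinearEquiv).ne_zero

/-- a function of the form `φ = B·x₂³ + B₁·x₂·x₁³` with `B, B₁` of class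
`C¹`, `B(0,0) ≠ 0` and `B₁(0,0) ≠ 0`, has a singularity of type `E₇` at the origin;
explicitly, the `C¹` change of variables `z₂ = x₂·(B x)^{1/3}`,
`z₁ = x₁·(B₁ x/(B x)^{1/3})^{1/3}` (real cube roots) has nonzero Jacobian determinant
at the origin and transforms `φ` into `z₂³ + z₂·z₁³` near the origin. -/
theorem stmt_8 (W : Set (ℝ × ℝ)) (hW : W ∈ nhds (0 : ℝ × ℝ))
    (φ B B₁ : ℝ × ℝ → ℝ)
    (hB : ContDiffOn ℝ 1 B W) (hB₁ : ContDiffOn ℝ 1 B₁ W)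
    (hB0 : B (0, 0) ≠ 0) (hB₁0 : B₁ (0, 0) ≠ 0)
    (hform : ∀ x ∈ W, φ x = B x * x.2 ^ 3 + B₁ x * x.2 * x.1 ^ 3) :
    HasE7 φ W ∧
    LinearMap.det ((fderiv ℝ
        (fun x : ℝ × ℝ => ((x.1 * cbrt (B₁ x / cbrt (B x)), x.2 * cbrt (B x)) : ℝ × ℝ))
        0) : (ℝ × ℝ) →ₗ[ℝ] ℝ × ℝ) ≠ 0 ∧
    ∃ W' ∈ nhds (0 : ℝ × ℝ), W' ⊆ W ∧
      ContDiffOn ℝ 1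
        (fun x : ℝ × ℝ => ((x.1 * cbrt (B₁ x / cbrt (B x)), x.2 * cbrt (B x)) : ℝ × ℝ))
        W' ∧
      ∀ x ∈ W', φ x =
        (x.2 * cbrt (B x)) ^ 3 +
          (x.2 * cbrt (B x)) * (x.1 * cbrt (B₁ x / cbrt (B x))) ^ 3 := by
  have hzero : ((0, 0) : ℝ × ℝ) = 0 := rfl
  rw [hzero] at hB0 hB₁0
  have hBat : ContDiffAt ℝ 1 B 0 := hB.contDiffAt hW
  have hB₁at : ContDiffAt ℝ 1 B₁ 0 := hB₁.contDiffAt hW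
  have hb : ContDiffAt ℝ 1 (fun x => cbrt (B x)) 0 := (contDiffAt_cbrt hB0).comp 0 hBat
  have hb0 : cbrt (B 0) ≠ 0 := cbrt_ne_zero hB0
  have hq0 : B₁ 0 / cbrt (B 0) ≠ 0 := div_ne_zero hB₁0 hb0
  have ha : ContDiffAt ℝ 1 (fun x => cbrt (B₁ x / cbrt (B x))) 0 :=
    ContDiffAt.comp 0 (g := cbrt) (contDiffAt_cbrt hq0) (hB₁at.div hb hb0)
  obtain ⟨e, he⟩ := exists_equiv_hasFDerivAt_mul (ha.differentiableAt one_ne_zero)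
    (hb.differentiableAt one_ne_zero) (cbrt_ne_zero hq0) hb0
  have hf : ContDiffAt ℝ 1
      (fun x : ℝ × ℝ => ((x.1 * cbrt (B₁ x / cbrt (B x)), x.2 * cbrt (B x)) : ℝ × ℝ)) 0 :=
    (contDiffAt_fst.mul ha).prodMk (contDiffAt_snd.mul hb)
  have hφ : ∀ x ∈ W, B x ≠ 0 → φ x =
      (x.2 * cbrt (B x)) ^ 3 + (x.2 * cbrt (B x)) * (x.1 * cbrt (B₁ x / cbrt (B x))) ^ 3 := by
    intro x hx hBx
    have hc := cbrt_ne_zero hBx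
    rw [hform x hx, mul_pow, mul_pow, cbrt_pow_three, cbrt_pow_three]
    field_simp
  have hne : ∀ᶠ x in nhds (0 : ℝ × ℝ), B x ≠ 0 := hBat.continuousAt.eventually_ne hB0
  set f : ℝ × ℝ → ℝ × ℝ :=
    fun x => (x.1 * cbrt (B₁ x / cbrt (B x)), x.2 * cbrt (B x)) with hfdef
  have hf0 : f 0 = 0 := by simp [hfdef]
  refine ⟨?_, ?_, ?_⟩
  · have hs := hf.hasStrictFDerivAt' he one_ne_zero
    have hg : ContDiffAt ℝ 1 (hs.localInverse f e 0) 0 := by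
      have := hf.to_localInverse he one_ne_zero
      rwa [hf0] at this
    have hg0 : hs.localInverse f e 0 0 = 0 := by
      have := hs.localInverse_apply_image
      rwa [hf0] at this
    have hg' : HasFDerivAt (hs.localInverse f e 0) (e.symm : (ℝ × ℝ) →L[ℝ] ℝ × ℝ) 0 := by
      have := hs.to_localInverse.hasFDerivAt
      rwa [hf0] at this
    have hright : ∀ᶠ y in nhds (0 : ℝ × ℝ), f (hs.localInverse f e 0 y) = y := by
      have := hs.eventually_right_inverse
      rwa [hf0] at this
    have htend : Filter.Tendsto (hs.localInverse f e 0) (nhds 0) (nhds 0) := by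
      have := hg.continuousAt.tendsto
      rwa [hg0] at this
    have hgood := (hg.eventually (by simp)).and
      (hright.and ((htend.eventually hW).and (htend.eventually hne)))
    refine ⟨_, hgood, hs.localInverse f e 0, fun y hy => hy.1.contDiffWithinAt, hg0, ?_, ?_, ?_⟩
    · rintro _ ⟨y, hy, rfl⟩
      exact hy.2.2.1
    · rw [hg'.fderiv]
      exact e.symm.det_toLinearMap_ne_zero
    · rintro y ⟨-, hy, hyW, hyB⟩
      have h1 := congrArg Prod.fst hy
      have h2 := congrArg Prod.snd hy
      simp only [hfdef] at h1 h2
      rw [hφ _ hyW hyB, h1, h2]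
      ring
  · rw [he.fderiv]
    exact e.det_toLinearMap_ne_zero
  · have hgood := (hf.eventually (by simp)).and (Filter.Eventually.and hW hne)
    exact ⟨_, hgood, fun x hx => hx.2.1, fun x hx => hx.1.contDiffWithinAt,
      fun x hx => hφ x hx.2.1 hx.2.2⟩
end

section
/- Let φ be a function on a neighborhood of the origin in ℝ² of the form φ(x₁,x₂) = b(x₁,x₂)·(x₂ − ψ(x₁))³ + (x₂ − ψ(x₁))·x₁⁵·b₁(x₁) + x₁⁵·b₀(x₁), where b, b₁, b₀ are of class C¹, ψ is of class C¹ with ψ(0) = 0, and b(0,0) ≠ 0, b₀(0) ≠ 0. Then φ has a singularity of type E₈ at the origin: there is a C¹ change of variables (x₁,x₂) ↦ (y₁,y₂), defined on a sufficiently small neighborhood of the origin, with nonzero Jacobian determinant at the origin, y₁ = x₁·(b₀(x₁) + (x₂ − ψ(x₁))·b₁(x₁))^{1/5} and y₂ = (b(x₁,x₂))^{1/3}·(x₂ − ψ(x₁)) (real odd roots), in which φ takes the form y₂³ + y₁⁵. -/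
open Set

/-- The real fifth root, defined for all real `t`. -/
noncomputable def fifthRoot (t : ℝ) : ℝ := Real.sign t * |t| ^ ((1 : ℝ) / 5)

/-- The signed real power `t ↦ sign t * |t| ^ r` is smooth away from the origin. -/
theorem contDiffAt_sign_mul_abs_rpow {n : WithTop ℕ∞} (r : ℝ) {t : ℝ} (ht : t ≠ 0) :
    ContDiffAt ℝ n (fun s : ℝ => Real.sign s * |s| ^ r) t := by
  rcases lt_or_gt_of_ne ht with h | h
  · have h1 : ContDiffAt ℝ n (fun s : ℝ => -((-s) ^ r)) t :=
      (contDiffAt_id.neg.rpow_const_of_ne (neg_ne_zero.mpr ht)).neg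
    refine h1.congr_of_eventuallyEq ?_
    filter_upwards [Iio_mem_nhds h] with s hs
    rw [Real.sign_of_neg hs, abs_of_neg (mem_Iio.mp hs), neg_one_mul]
  · have h1 : ContDiffAt ℝ n (fun s : ℝ => s ^ r) t :=
      contDiffAt_id.rpow_const_of_ne ht
    refine h1.congr_of_eventuallyEq ?_
    filter_upwards [Ioi_mem_nhds h] with s hs
    rw [Real.sign_of_pos hs, abs_of_pos (mem_Ioi.mp hs), one_mul]

theorem fifthRoot_pow_five (t : ℝ) : fifthRoot t ^ 5 = t := by
  have h : (|t| ^ ((1 : ℝ) / 5)) ^ 5 = |t| := by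
    rw [← Real.rpow_natCast, ← Real.rpow_mul (abs_nonneg t)]
    norm_num
  rw [fifthRoot, mul_pow, h]
  rcases lt_trichotomy t 0 with ht | rfl | ht
  · rw [Real.sign_of_neg ht, abs_of_neg ht]; ring
  · simp
  · rw [Real.sign_of_pos ht, abs_of_pos ht]; ring

theorem fifthRoot_ne_zero {t : ℝ} (ht : t ≠ 0) : fifthRoot t ≠ 0 := fun h =>
  ht (by rw [← fifthRoot_pow_five t, h]; norm_num)

/-- The determinant of the derivative at the origin of `x ↦ (x.1 * A x, B x * (x.2 - ψ x.1))`. -/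
theorem det_fderiv_triangular {A B : ℝ × ℝ → ℝ} {ψ : ℝ → ℝ} (hA : DifferentiableAt ℝ A 0)
    (hB : DifferentiableAt ℝ B 0) (hψ : DifferentiableAt ℝ ψ 0) (hψ0 : ψ 0 = 0) :
    LinearMap.det ((fderiv ℝ (fun x : ℝ × ℝ => ((x.1 * A x, B x * (x.2 - ψ x.1)) : ℝ × ℝ)) 0) :
      (ℝ × ℝ) →ₗ[ℝ] ℝ × ℝ) = A 0 * B 0 := by
  have h1 : HasFDerivAt (fun x : ℝ × ℝ => x.1) (ContinuousLinearMap.fst ℝ ℝ ℝ) 0 := hasFDerivAt_fst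
  have h2 : HasFDerivAt (fun x : ℝ × ℝ => x.2) (ContinuousLinearMap.snd ℝ ℝ ℝ) 0 := hasFDerivAt_snd
  have h3 : HasFDerivAt (fun x : ℝ × ℝ => ψ x.1)
      (deriv ψ 0 • ContinuousLinearMap.fst ℝ ℝ ℝ) 0 :=
    HasDerivAt.comp_hasFDerivAt (h₂ := ψ) (0 : ℝ × ℝ) hψ.hasDerivAt h1
  have h4 := ((h1.fun_mul hA.hasFDerivAt).prodMk
    (hB.hasFDerivAt.fun_mul (h2.fun_sub h3))).fderiv
  rw [h4, ← LinearMap.det_toMatrix (Module.Basis.finTwoProd ℝ), Matrix.det_fin_two]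
  simp [LinearMap.toMatrix_apply, hψ0]

/-- The inverse function theorem at the origin, for a `C¹` map with nonzero Jacobian determinant. -/
theorem exists_contDiffAt_right_inverse {E : Type*} [NormedAddCommGroup E] [NormedSpace ℝ E]
    [FiniteDimensional ℝ E] {f : E → E} (hf : ContDiffAt ℝ 1 f 0) (hf0 : f 0 = 0)
    (hdet : LinearMap.det ((fderiv ℝ f 0) : E →ₗ[ℝ] E) ≠ 0) :
    ∃ g : E → E, ContDiffAt ℝ 1 g 0 ∧ g 0 = 0 ∧
      LinearMap.det ((fderiv ℝ g 0) : E →ₗ[ℝ] E) ≠ 0 ∧ ∀ᶠ y in nhds 0, f (g y) = y := by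
  have : CompleteSpace E := FiniteDimensional.complete ℝ E
  let e : E ≃L[ℝ] E := (fderiv ℝ f 0).toContinuousLinearEquivOfDetNeZero hdet
  have he : HasFDerivAt f (e : E →L[ℝ] E) 0 := (hf.differentiableAt one_ne_zero).hasFDerivAt
  have hs : HasStrictFDerivAt f (e : E →L[ℝ] E) 0 := hf.hasStrictFDerivAt' he one_ne_zero
  have hg : ContDiffAt ℝ 1 (hs.localInverse f e 0) 0 := by
    have := hf.to_localInverse he one_ne_zero
    rwa [hf0] at this
  have hg0 : hs.localInverse f e 0 0 = 0 := by
    have := hs.localInverse_apply_image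
    rwa [hf0] at this
  have hr : ∀ᶠ y in nhds 0, f (hs.localInverse f e 0 y) = y := by
    have := hs.eventually_right_inverse
    rwa [hf0] at this
  refine ⟨hs.localInverse f e 0, hg, hg0, ?_, hr⟩
  have hd := (hg.differentiableAt one_ne_zero).hasFDerivAt
  have hc : HasFDerivAt (f ∘ hs.localInverse f e 0)
      ((e : E →L[ℝ] E).comp (fderiv ℝ (hs.localInverse f e 0) 0)) 0 :=
    HasFDerivAt.comp (0 : E) (by rwa [hg0]) hd
  have hid := hc.unique ((hasFDerivAt_id (0 : E)).congr_of_eventuallyEq hr)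
  have hmul := congrArg (fun L : E →L[ℝ] E => LinearMap.det (L : E →ₗ[ℝ] E)) hid
  simp only [ContinuousLinearMap.toLinearMap_comp, LinearMap.det_comp] at hmul
  intro h0
  rw [h0] at hmul
  simp at hmul

/-- a function of the form
`φ(x₁,x₂) = b(x₁,x₂)·(x₂ - ψ(x₁))³ + (x₂ - ψ(x₁))·x₁⁵·b₁(x₁) + x₁⁵·b₀(x₁)` with
`b, b₁, b₀` of class `C¹`, `ψ` of class `C¹` with `ψ 0 = 0`, `b(0,0) ≠ 0` and
`b₀(0) ≠ 0`, has a singularity of type `E₈` at the origin; the `C¹` change of variables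
`y₁ = x₁·(b₀(x₁) + (x₂ - ψ(x₁))·b₁(x₁))^{1/5}`, `y₂ = (b(x₁,x₂))^{1/3}·(x₂ - ψ(x₁))`
(real odd roots) has nonzero Jacobian determinant at the origin and puts `φ` in the
form `y₂³ + y₁⁵` near the origin. -/
theorem stmt_9 (W : Set (ℝ × ℝ)) (hW : W ∈ nhds (0 : ℝ × ℝ))
    (φ b : ℝ × ℝ → ℝ) (b₁ b₀ ψ : ℝ → ℝ)
    (hb : ContDiffOn ℝ 1 b W)
    (hb₁ : ContDiff ℝ 1 b₁) (hb₀ : ContDiff ℝ 1 b₀) (hψ : ContDiff ℝ 1 ψ)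
    (hψ0 : ψ 0 = 0) (hb0 : b (0, 0) ≠ 0) (hb₀0 : b₀ 0 ≠ 0)
    (hform : ∀ x ∈ W, φ x = b x * (x.2 - ψ x.1) ^ 3 +
      (x.2 - ψ x.1) * x.1 ^ 5 * b₁ x.1 + x.1 ^ 5 * b₀ x.1) :
    HasE8 φ W ∧
    LinearMap.det ((fderiv ℝ
        (fun x : ℝ × ℝ =>
          ((x.1 * fifthRoot (b₀ x.1 + (x.2 - ψ x.1) * b₁ x.1),
            cbrt (b x) * (x.2 - ψ x.1)) : ℝ × ℝ)) 0) : (ℝ × ℝ) →ₗ[ℝ] ℝ × ℝ) ≠ 0 ∧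
    ∃ W' ∈ nhds (0 : ℝ × ℝ), W' ⊆ W ∧
      ContDiffOn ℝ 1
        (fun x : ℝ × ℝ =>
          ((x.1 * fifthRoot (b₀ x.1 + (x.2 - ψ x.1) * b₁ x.1),
            cbrt (b x) * (x.2 - ψ x.1)) : ℝ × ℝ)) W' ∧
      ∀ x ∈ W', φ x =
        (cbrt (b x) * (x.2 - ψ x.1)) ^ 3 +
          (x.1 * fifthRoot (b₀ x.1 + (x.2 - ψ x.1) * b₁ x.1)) ^ 5 := by
  set A : ℝ × ℝ → ℝ := fun x => fifthRoot (b₀ x.1 + (x.2 - ψ x.1) * b₁ x.1) with hAdef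
  set B : ℝ × ℝ → ℝ := fun x => cbrt (b x) with hBdef
  have hA : ContDiffAt ℝ 1 A 0 := by
    have h : ContDiff ℝ 1 (fun x : ℝ × ℝ => b₀ x.1 + (x.2 - ψ x.1) * b₁ x.1) := by fun_prop
    exact (contDiffAt_sign_mul_abs_rpow (1 / 5) (by simpa [hψ0] using hb₀0)).comp
      (0 : ℝ × ℝ) h.contDiffAt
  have hB : ContDiffAt ℝ 1 B 0 :=
    (contDiffAt_sign_mul_abs_rpow (1 / 3) hb0).comp (0 : ℝ × ℝ) (hb.contDiffAt hW)
  have hΦ : ContDiffAt ℝ 1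
      (fun x : ℝ × ℝ => ((x.1 * A x, B x * (x.2 - ψ x.1)) : ℝ × ℝ)) 0 := by
    have h : ContDiff ℝ 1 (fun x : ℝ × ℝ => x.2 - ψ x.1) := by fun_prop
    exact (contDiffAt_fst.mul hA).prodMk (hB.mul h.contDiffAt)
  have hdet : LinearMap.det ((fderiv ℝ
      (fun x : ℝ × ℝ => ((x.1 * A x, B x * (x.2 - ψ x.1)) : ℝ × ℝ)) 0) :
      (ℝ × ℝ) →ₗ[ℝ] ℝ × ℝ) ≠ 0 := by
    rw [det_fderiv_triangular (hA.differentiableAt one_ne_zero) (hB.differentiableAt one_ne_zero)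
      (hψ.differentiable one_ne_zero 0) hψ0]
    refine mul_ne_zero (fifthRoot_ne_zero ?_) (cbrt_ne_zero hb0)
    simpa [hψ0] using hb₀0
  have hφ : ∀ x ∈ W, φ x = (B x * (x.2 - ψ x.1)) ^ 3 + (x.1 * A x) ^ 5 := by
    intro x hx
    rw [hform x hx, mul_pow, mul_pow, hAdef, hBdef]
    simp only [cbrt_pow_three, fifthRoot_pow_five]
    ring
  refine ⟨?_, hdet, ?_⟩
  · obtain ⟨g, hg, hg0, hgdet, hright⟩ :=
      exists_contDiffAt_right_inverse hΦ (by simp [hψ0]) hdet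
    obtain ⟨u, hu, hgu⟩ := hg.contDiffOn le_rfl (by simp)
    have hgW : ∀ᶠ y in nhds 0, g y ∈ W := hg.continuousAt.eventually (by rwa [hg0])
    refine ⟨u ∩ {y | g y ∈ W ∧ _}, Filter.inter_mem (by simpa using hu) (hgW.and hright), g,
      hgu.mono inter_subset_left, hg0, ?_, hgdet, ?_⟩
    · rintro _ ⟨y, hy, rfl⟩
      exact hy.2.1
    · rintro y ⟨-, hyW, hy⟩
      have hfst := congrArg Prod.fst hy
      have hsnd := congrArg Prod.snd hy
      dsimp only at hfst hsnd
      rw [hφ _ hyW, hfst, hsnd, add_comm]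
  · obtain ⟨u, hu, hΦu⟩ := hΦ.contDiffOn le_rfl (by simp)
    exact ⟨u ∩ W, Filter.inter_mem (by simpa using hu) hW, inter_subset_right,
      hΦu.mono inter_subset_left, fun x hx => hφ x hx.2⟩
end

section
/- Let φ be a function on a neighborhood of the origin in ℝ² of the form φ(x₁,x₂) = b₃(x₁,x₂)·x₂³ + x₂·x₁^{k₁}·b₁(x₁) + x₁^{k₀}·b₀(x₁), where b₃, b₁, b₀ are C^∞ functions with b₃(0,0) ≠ 0, and k₁ ≥ 4 and k₀ ≥ 6 are integers. Then φ does not have a singularity of type E₈ at the origin. -/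
open Set

open Filter Topology Asymptotics

/-- If `y₁⁵ + y₂³` is `O(t⁶)` along two curves `p` and `p + d`, where `p ~ t • (a, b)` and
`d ~ t² • (c, e)`, then `(a, b)` and `(c, e)` are linearly dependent. -/
theorem det_eq_zero_of_isBigO_pow_six {p₁ p₂ d₁ d₂ : ℝ → ℝ} {a b c e : ℝ}
    (hp₁ : Tendsto (fun t => p₁ t / t) (𝓝[>] 0) (𝓝 a))
    (hp₂ : Tendsto (fun t => p₂ t / t) (𝓝[>] 0) (𝓝 b))
    (hd₁ : Tendsto (fun t => d₁ t / t ^ 2) (𝓝[>] 0) (𝓝 c))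
    (hd₂ : Tendsto (fun t => d₂ t / t ^ 2) (𝓝[>] 0) (𝓝 e))
    (hp : (fun t => p₁ t ^ 5 + p₂ t ^ 3) =O[𝓝[>] 0] fun t : ℝ => t ^ 6)
    (hq : (fun t => (p₁ t + d₁ t) ^ 5 + (p₂ t + d₂ t) ^ 3) =O[𝓝[>] 0] fun t : ℝ => t ^ 6) :
    a * e - c * b = 0 := by
  have hid : Tendsto (fun t : ℝ => t) (𝓝[>] 0) (𝓝 0) := tendsto_nhdsWithin_of_tendsto_nhds tendsto_id
  have hpos : ∀ᶠ t : ℝ in 𝓝[>] 0, 0 < t := self_mem_nhdsWithin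
  obtain ⟨C, hC⟩ := hp.bound
  obtain ⟨D, hD⟩ := hq.bound
  have hlow : ∀ n < 6, Tendsto (fun t => (p₁ t ^ 5 + p₂ t ^ 3) / t ^ n) (𝓝[>] 0) (𝓝 0) := by
    intro n hn
    refine (hp.trans_isLittleO ?_).tendsto_div_nhds_zero
    exact (isLittleO_pow_pow hn).mono nhdsWithin_le_nhds
  have hb : b = 0 := by
    have h := (hlow 3 (by norm_num)).sub ((hp₁.pow 5).mul (hid.pow 2))
    have h' : Tendsto (fun t => (p₂ t / t) ^ 3) (𝓝[>] 0) (𝓝 0) := by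
      refine (h.congr' ?_).trans (by simp)
      filter_upwards [hpos] with t ht
      field_simp
      ring
    have := tendsto_nhds_unique h' (hp₂.pow 3)
    exact pow_eq_zero_iff (by norm_num) |>.1 this.symm
  subst hb
  by_cases he : e = 0
  · simp [he]
  have hcube : Tendsto (fun t => p₂ t ^ 3 / t ^ 5) (𝓝[>] 0) (𝓝 (0 - a ^ 5)) := by
    refine ((hlow 5 (by norm_num)).sub (hp₁.pow 5)).congr' ?_
    filter_upwards [hpos] with t ht
    field_simp
    ring
  have hdiff : (fun t => (p₁ t + d₁ t) ^ 5 - p₁ t ^ 5) =O[𝓝[>] 0] fun t : ℝ => t ^ 6 := by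
    have hlim : Tendsto (fun t => d₁ t / t ^ 2 * ((p₁ t / t + d₁ t / t ^ 2 * t) ^ 4
        + (p₁ t / t + d₁ t / t ^ 2 * t) ^ 3 * (p₁ t / t)
        + (p₁ t / t + d₁ t / t ^ 2 * t) ^ 2 * (p₁ t / t) ^ 2
        + (p₁ t / t + d₁ t / t ^ 2 * t) * (p₁ t / t) ^ 3 + (p₁ t / t) ^ 4)) (𝓝[>] 0) (𝓝 _) :=
      have hs := hp₁.add (hd₁.mul hid)
      hd₁.mul (((((hs.pow 4).add ((hs.pow 3).mul hp₁)).add ((hs.pow 2).mul (hp₁.pow 2))).add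
        (hs.mul (hp₁.pow 3))).add (hp₁.pow 4))
    have h := (hlim.isBigO_one ℝ).mul (isBigO_refl (fun t : ℝ => t ^ 6) (𝓝[>] 0))
    refine h.congr' ?_ (by simp)
    filter_upwards [hpos] with t ht
    field_simp
    ring
  have hprod : (fun t => d₂ t * (3 * p₂ t ^ 2 + 3 * p₂ t * d₂ t + d₂ t ^ 2))
      =O[𝓝[>] 0] fun t : ℝ => t ^ 6 :=
    ((hq.sub hp).sub hdiff).congr_left fun t => by ring
  have hsq : (fun t => d₂ t * p₂ t ^ 2) =O[𝓝[>] 0] fun t : ℝ => t ^ 6 := by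
    refine (IsBigO.of_bound (4 / 3) (.of_forall fun t => ?_)).trans hprod
    rw [norm_mul, norm_mul, Real.norm_of_nonneg (sq_nonneg (p₂ t)), mul_left_comm]
    refine mul_le_mul_of_nonneg_left ?_ (norm_nonneg _)
    refine le_trans ?_ (mul_le_mul_of_nonneg_left (Real.le_norm_self _) (by norm_num))
    nlinarith [sq_nonneg (3 * p₂ t + 2 * d₂ t)]
  have hp₂sq : (fun t => (p₂ t / t ^ 2) ^ 2) =O[𝓝[>] 0] fun _ : ℝ => (1 : ℝ) := by
    have h := ((hd₂.inv₀ he).isBigO_one ℝ).mul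
      (hsq.mul (isBigO_refl (fun t : ℝ => (t ^ 6)⁻¹) (𝓝[>] 0)))
    refine h.congr' ?_ ?_
    · filter_upwards [hpos, hd₂.eventually_ne he] with t ht hne
      have : d₂ t ≠ 0 := by rintro h0; simp [h0] at hne
      field_simp
    · filter_upwards [hpos] with t ht
      field_simp
  have hcube₀ : Tendsto (fun t => p₂ t ^ 3 / t ^ 5) (𝓝[>] 0) (𝓝 0) := by
    have h := (hp₂sq.mul_isLittleO ((isLittleO_one_iff ℝ).2 hp₂))
    simp only [mul_one] at h
    refine ((isLittleO_one_iff ℝ).1 h).congr' ?_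
    filter_upwards [hpos] with t ht
    field_simp
  have ha : a = 0 := by
    have := tendsto_nhds_unique hcube hcube₀
    exact pow_eq_zero_iff (n := 5) (by norm_num) |>.1 (by linarith)
  simp [ha]

/-- The columns of an injective linear endomorphism of the plane have nonzero determinant. -/
theorem det_columns_ne_zero {M : ℝ × ℝ →L[ℝ] ℝ × ℝ} (hM : Function.Injective M) :
    (M (1, 0)).1 * (M (0, 1)).2 - (M (0, 1)).1 * (M (1, 0)).2 ≠ 0 := by
  intro h
  have hlin : ∀ x y : ℝ, M (x, y) = x • M (1, 0) + y • M (0, 1) := fun x y => by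
    rw [← map_smul, ← map_smul, ← map_add]; simp
  have h₁ : M ((M (0, 1)).2, -(M (1, 0)).2) = M 0 := by
    rw [hlin, map_zero]; ext <;> simp <;> linarith
  have h₂ : M ((M (0, 1)).1, -(M (1, 0)).1) = M 0 := by
    rw [hlin, map_zero]; ext <;> simp <;> linarith
  have e₁ := congrArg Prod.snd (hM h₁)
  have e₂ := congrArg Prod.snd (hM h₂)
  have h₀ : M (1, 0) = M 0 := by
    rw [map_zero]; ext <;> simp at * <;> assumption
  simpa using hM h₀

/-- Strict differentiability along two curves whose difference is `s t • v`. -/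
theorem HasStrictFDerivAt.tendsto_inv_smul_sub {α E F : Type*} [NormedAddCommGroup E]
    [NormedSpace ℝ E] [NormedAddCommGroup F] [NormedSpace ℝ F] {f : E → F} {f' : E →L[ℝ] F}
    {x : E} (hf : HasStrictFDerivAt f f' x) {l : Filter α} {u w : α → E} {s : α → ℝ} {v : E}
    (hu : Tendsto u l (𝓝 x)) (hw : Tendsto w l (𝓝 x)) (hs : ∀ᶠ t in l, s t ≠ 0)
    (huw : ∀ t, u t - w t = s t • v) :
    Tendsto (fun t => (s t)⁻¹ • (f (u t) - f (w t))) l (𝓝 (f' v)) := by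
  have h := hf.isLittleO.comp_tendsto (hu.prodMk_nhds hw)
  have h₁ : (fun t => f (u t) - f (w t) - s t • f' v) =o[l] s := by
    refine IsLittleO.trans_isBigO (g := fun t => s t • v) ?_ ?_
    · simpa only [Function.comp_def, ← map_sub, huw, map_smul] using h
    · exact IsBigO.of_bound ‖v‖ (.of_forall fun t => by rw [norm_smul, mul_comm])
  have h₂ : Tendsto (fun t => (s t)⁻¹ • (f (u t) - f (w t) - s t • f' v)) l (𝓝 0) := by
    rw [← isLittleO_one_iff ℝ]
    refine ((isBigO_refl (fun t => (s t)⁻¹) l).smul_isLittleO h₁).trans_isBigO ?_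
    refine IsBigO.of_bound 1 (.of_forall fun t => ?_)
    by_cases h0 : s t = 0 <;> simp [h0]
  refine ((h₂.add_const (f' v)).congr' ?_).trans (by simp)
  filter_upwards [hs] with t ht
  rw [smul_sub, smul_smul, inv_mul_cancel₀ ht, one_smul, sub_add_cancel]

/-- a function of the form
`φ(x₁,x₂) = b₃(x₁,x₂)·x₂³ + x₂·x₁^{k₁}·b₁(x₁) + x₁^{k₀}·b₀(x₁)` with `b₃, b₁, b₀` of
class `C^∞`, `b₃(0,0) ≠ 0`, `k₁ ≥ 4` and `k₀ ≥ 6`, does not have a singularity of type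
`E₈` at the origin. -/
theorem stmt_14 (W : Set (ℝ × ℝ)) (hW : W ∈ nhds (0 : ℝ × ℝ))
    (φ b₃mixed : ℝ × ℝ → ℝ) (b₁ b₀ : ℝ → ℝ)
    (hb₃ : ContDiff ℝ (⊤ : ℕ∞) b₃mixed) (hb₁ : ContDiff ℝ (⊤ : ℕ∞) b₁) (hb₀ : ContDiff ℝ (⊤ : ℕ∞) b₀)
    (hb₃0 : b₃mixed (0, 0) ≠ 0) (k₁ k₀ : ℕ) (hk₁ : 4 ≤ k₁) (hk₀ : 6 ≤ k₀)
    (hform : ∀ x ∈ W,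
      φ x = b₃mixed x * x.2 ^ 3 + x.2 * x.1 ^ k₁ * b₁ x.1 + x.1 ^ k₀ * b₀ x.1) :
    ¬ HasE8 φ W := by
  rintro ⟨V, hV, ϕ, hϕ, hϕ0, -, hdet, hE⟩
  set L := (fderiv ℝ ϕ 0).toContinuousLinearEquivOfDetNeZero hdet with hL
  have hstrict : HasStrictFDerivAt ϕ (L : ℝ × ℝ →L[ℝ] ℝ × ℝ) 0 := by
    have := (hϕ.contDiffAt hV).hasStrictFDerivAt one_ne_zero
    simpa [hL] using this
  set ψ := hstrict.localInverse ϕ L 0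
  set M : ℝ × ℝ →L[ℝ] ℝ × ℝ := (L.symm : ℝ × ℝ →L[ℝ] ℝ × ℝ)
  have hψ : HasStrictFDerivAt ψ M 0 := by
    have := hstrict.to_localInverse
    rwa [hϕ0] at this
  have hψ0 : ψ 0 = 0 := by
    have := hstrict.localInverse_apply_image
    rwa [hϕ0] at this
  have hinv : ∀ᶠ x in 𝓝 0, ϕ (ψ x) = x := by
    have := hstrict.eventually_right_inverse
    rwa [hϕ0] at this
  have hψV : ∀ᶠ x in 𝓝 0, ψ x ∈ V := by
    have := hψ.continuousAt
    rw [ContinuousAt, hψ0] at this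
    exact this hV
  have hφψ : ∀ᶠ x in 𝓝 0, (ψ x).1 ^ 5 + (ψ x).2 ^ 3 =
      b₃mixed x * x.2 ^ 3 + x.2 * x.1 ^ k₁ * b₁ x.1 + x.1 ^ k₀ * b₀ x.1 := by
    filter_upwards [hinv, hψV, hW] with x hx hxV hxW
    rw [← hE _ hxV, hx, hform x hxW]
  have hcurve : ∀ r : ℝ, Tendsto (fun t : ℝ => (t, r * t ^ 2)) (𝓝[>] 0) (𝓝 (0 : ℝ × ℝ)) := by
    intro r
    have : Continuous fun t : ℝ => (t, r * t ^ 2) := by fun_prop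
    exact (this.tendsto' 0 0 (by simp)).mono_left nhdsWithin_le_nhds
  have hbound : ∀ r : ℝ, (fun t : ℝ => (ψ (t, r * t ^ 2)).1 ^ 5 + (ψ (t, r * t ^ 2)).2 ^ 3)
      =O[𝓝[>] 0] fun t : ℝ => t ^ 6 := by
    intro r
    have c₃ := hb₃.continuous
    have c₁ := hb₁.continuous
    have c₀ := hb₀.continuous
    have hg : Continuous fun t : ℝ => b₃mixed (t, r * t ^ 2) * r ^ 3
        + r * t ^ (k₁ - 4) * b₁ t + t ^ (k₀ - 6) * b₀ t := by fun_prop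
    have h := (((hg.tendsto 0).isBigO_one ℝ).mono nhdsWithin_le_nhds).mul
      (isBigO_refl (fun t : ℝ => t ^ 6) (𝓝[>] 0))
    refine h.congr' ?_ (by simp)
    filter_upwards [(hcurve r).eventually hφψ] with t ht
    obtain ⟨m, rfl⟩ := Nat.exists_eq_add_of_le hk₁
    obtain ⟨n, rfl⟩ := Nat.exists_eq_add_of_le hk₀
    simp only [ht, Nat.add_sub_cancel_left]
    ring
  have hp : Tendsto (fun t : ℝ => t⁻¹ • ψ (t, 0 * t ^ 2)) (𝓝[>] 0) (𝓝 (M (1, 0))) := by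
    have h := hψ.tendsto_inv_smul_sub (hcurve 0) tendsto_const_nhds (s := fun t => t)
      (v := (1, 0)) (eventually_mem_nhdsWithin.mono fun t ht => ne_of_gt ht) (by simp)
    simpa only [hψ0, sub_zero] using h
  have hd : Tendsto (fun t : ℝ => (t ^ 2)⁻¹ • (ψ (t, 1 * t ^ 2) - ψ (t, 0 * t ^ 2)))
      (𝓝[>] 0) (𝓝 (M (0, 1))) := by
    exact hψ.tendsto_inv_smul_sub (hcurve 1) (hcurve 0)
      (eventually_mem_nhdsWithin.mono fun t ht => pow_ne_zero 2 (ne_of_gt ht)) (by simp)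
  refine det_columns_ne_zero (M := M) L.symm.injective
    (det_eq_zero_of_isBigO_pow_six (p₁ := fun t => (ψ (t, 0 * t ^ 2)).1)
      (p₂ := fun t => (ψ (t, 0 * t ^ 2)).2)
      (d₁ := fun t => (ψ (t, 1 * t ^ 2)).1 - (ψ (t, 0 * t ^ 2)).1)
      (d₂ := fun t => (ψ (t, 1 * t ^ 2)).2 - (ψ (t, 0 * t ^ 2)).2)
      ?_ ?_ ?_ ?_ (hbound 0) ?_)
  · exact hp.fst_nhds.congr fun t => by simp [div_eq_inv_mul]
  · exact hp.snd_nhds.congr fun t => by simp [div_eq_inv_mul]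
  · exact hd.fst_nhds.congr fun t => by simp [div_eq_inv_mul]
  · exact hd.snd_nhds.congr fun t => by simp [div_eq_inv_mul]
  · simpa only [add_sub_cancel] using hbound 1
end
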